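/- arXiv:2204.03754 — 2 statements merged into one kernel-verified Lean document; each statement's English description precedes it below -/
import Mathlib

section
/- Let k ≥ 2 be fixed. There is a constant C = C(k) such that for all X ≥ 2 and all H₂ with X^{1−1/(50k)} ≤ H₂ ≤ X, one has max_{a, q ∈ ℕ} |∑_{X < n ≤ X+H₂, n ≡ a (mod q)} (d_k(n) − d_k♯(n))| ≤ C · (H₂²/X) · (log X)^{k−2}. -/
open Finset

/-- The `k`-th divisor function: the number of tuples `(n₁, …, n_k)` of positive
integers with `n₁ ⋯ n_k = n`. -/
def dk (k n : ℕ) : ℕ :=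
  ((Fintype.piFinset fun _ : Fin k => Finset.range (n + 1)).filter
    fun v => ∏ i, v i = n).card

/-- The parameter `R_k = X^{1/(10k)}`. -/
noncomputable def Rk (k : ℕ) (X : ℝ) : ℝ := X ^ ((1 : ℝ) / (10 * k))

/-- The polynomial `P_m(t)` appearing in the definition of the approximant `d_k♯`. -/
noncomputable def Pm (k : ℕ) (X : ℝ) (m : ℕ) (t : ℝ) : ℝ :=
  ∑ j ∈ Finset.range k, (k.choose j : ℝ) *
    ∑ ν ∈ (Fintype.piFinset fun _ : Fin (k - 1) => Finset.Icc 1 m).filter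
        (fun ν => (∀ i : Fin (k - 1),
            ((i : ℕ) < j → (ν i : ℝ) ≤ Rk k X) ∧
            (j ≤ (i : ℕ) → Rk k X < (ν i : ℝ) ∧ (ν i : ℝ) ≤ Rk k X ^ 2)) ∧
          ∏ i, ν i = m),
      (t - Real.log
          ((∏ i ∈ Finset.univ.filter fun i : Fin (k - 1) => (i : ℕ) < j, ((ν i : ℝ))) *
            Rk k X ^ (k - j))) ^ (k - j - 1) /
        ((Nat.factorial (k - j - 1) : ℝ) * Real.log (Rk k X) ^ (k - j - 1))

/-- The type I approximant `d_k♯(n) = ∑_{m ≤ R_k^{2k-2}, m ∣ n} P_m(log n)`. -/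
noncomputable def dkSharp (k : ℕ) (X : ℝ) (n : ℕ) : ℝ :=
  ∑ m ∈ (Finset.Icc 1 ⌊Rk k X ^ (2 * k - 2)⌋₊).filter (fun m => m ∣ n),
    Pm k X m (Real.log n)

/-- The dilation-sum operator `Φ ↦ (y ↦ ∑_{x ∈ s} Φ (x y))` on functions `ℕ → ℝ`. -/
def mulSum (s : Finset ℕ) : Module.End ℝ (ℕ → ℝ) where
  toFun Φ y := ∑ x ∈ s, Φ (x * y)
  map_add' Φ Ψ := by ext y; simp [Finset.sum_add_distrib]
  map_smul' c Φ := by ext y; simp [Finset.mul_sum]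

lemma mulSum_apply (s : Finset ℕ) (Φ : ℕ → ℝ) (y : ℕ) :
    mulSum s Φ y = ∑ x ∈ s, Φ (x * y) := rfl

lemma mulSum_commute (s t : Finset ℕ) : Commute (mulSum s) (mulSum t) := by
  ext Φ y
  simp only [Module.End.mul_apply, mulSum_apply]
  rw [Finset.sum_comm]
  refine Finset.sum_congr rfl fun a _ => Finset.sum_congr rfl fun b _ => ?_
  rw [mul_left_comm]

lemma mulSum_union {s t : Finset ℕ} (h : Disjoint s t) :
    mulSum (s ∪ t) = mulSum s + mulSum t := by
  ext Φ y
  simp [mulSum_apply, Finset.sum_union h]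

lemma mulSum_pow_succ_apply (s : Finset ℕ) (l : ℕ) (Φ : ℕ → ℝ) (y : ℕ) :
    (mulSum s ^ (l + 1)) Φ y = ∑ x ∈ s, (mulSum s ^ l) Φ (x * y) := by
  rw [pow_succ', Module.End.mul_apply, mulSum_apply]

lemma mulSum_pow_apply (s : Finset ℕ) (l : ℕ) (Φ : ℕ → ℝ) (y : ℕ) :
    (mulSum s ^ l) Φ y = (mulSum s ^ l) (fun n => Φ (n * y)) 1 := by
  induction l generalizing y Φ with
  | zero => simp
  | succ l ih =>
    rw [mulSum_pow_succ_apply, mulSum_pow_succ_apply]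
    refine Finset.sum_congr rfl fun x _ => ?_
    rw [ih Φ, ih (fun n => Φ (n * y)) (x * 1)]
    simp [mul_assoc]

lemma mulSum_pow_succ_one (s : Finset ℕ) (l : ℕ) (Φ : ℕ → ℝ) :
    (mulSum s ^ (l + 1)) Φ 1 = ∑ x ∈ s, (mulSum s ^ l) (fun n => Φ (x * n)) 1 := by
  rw [mulSum_pow_succ_apply]
  refine Finset.sum_congr rfl fun x _ => ?_
  rw [mulSum_pow_apply]
  simp [mul_comm]

lemma sum_piFinset_succ {d : ℕ} (S : Fin (d + 1) → Finset ℕ) (G : (Fin (d + 1) → ℕ) → ℝ) :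
    ∑ v ∈ Fintype.piFinset S, G v =
      ∑ x ∈ S 0, ∑ v ∈ Fintype.piFinset (fun i : Fin d => S i.succ), G (Fin.cons x v) := by
  rw [← Finset.sum_product']
  refine Finset.sum_nbij' (fun v => (v 0, fun i => v i.succ)) (fun p => Fin.cons p.1 p.2)
    ?_ ?_ ?_ ?_ ?_
  · intro v hv
    rw [Fintype.mem_piFinset] at hv
    simp [hv]
  · intro p hp
    simp only [Finset.mem_product, Fintype.mem_piFinset] at hp ⊢
    intro i
    refine Fin.cases ?_ (fun i => ?_) i
    · simpa using hp.1
    · simpa using hp.2 i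
  · intro v _
    exact Fin.cons_self_tail v
  · intro p _
    simp
  · intro v _
    congr 1
    exact (Fin.cons_self_tail v).symm

lemma sum_piFinset_const (s : Finset ℕ) (d : ℕ) (Φ : ℕ → ℝ) :
    ∑ v ∈ Fintype.piFinset (fun _ : Fin d => s), Φ (∏ i, v i) = (mulSum s ^ d) Φ 1 := by
  induction d generalizing Φ with
  | zero => simp
  | succ d ih =>
    rw [sum_piFinset_succ, mulSum_pow_succ_one]
    refine Finset.sum_congr rfl fun x _ => ?_
    rw [← ih]
    refine Finset.sum_congr rfl fun v _ => ?_
    rw [Fin.prod_univ_succ]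
    simp

lemma sum_piFinset_mixed (s t : Finset ℕ) (d j : ℕ) (hj : j ≤ d) (F : ℕ → ℕ → ℝ) :
    ∑ v ∈ Fintype.piFinset (fun i : Fin d => if (i : ℕ) < j then s else t),
        F (∏ i ∈ Finset.univ.filter (fun i : Fin d => (i : ℕ) < j), v i) (∏ i, v i) =
      (mulSum s ^ j) (fun b => (mulSum t ^ (d - j)) (fun c => F b (b * c)) 1) 1 := by
  induction d generalizing j F with
  | zero =>
    obtain rfl : j = 0 := by omega
    simp
  | succ d ih =>
    cases j with
    | zero =>
      simp only [Nat.not_lt_zero, if_false, Finset.filter_false, Finset.prod_empty, pow_zero,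
        Module.End.one_apply, Nat.sub_zero, one_mul]
      exact sum_piFinset_const t (d + 1) (F 1)
    | succ j =>
      rw [sum_piFinset_succ, mulSum_pow_succ_one]
      simp only [Fin.val_zero, Nat.zero_lt_succ, if_true, Fin.val_succ, Nat.add_lt_add_iff_right,
        Nat.add_sub_add_right]
      refine Finset.sum_congr rfl fun x _ => ?_
      have := ih j (by omega) (fun b n => F (x * b) (x * n))
      simp only [mul_assoc] at this ⊢
      rw [← this]
      refine Finset.sum_congr rfl fun v _ => ?_
      rw [Fin.prod_univ_succ, Finset.prod_filter, Finset.prod_filter, Fin.prod_univ_succ]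
      simp

lemma abs_mulSum_pow_le_of_le {s : Finset ℕ} {R : ℝ} (hs : ∀ x ∈ s, 1 ≤ x ∧ (x : ℝ) ≤ R)
    (j : ℕ) {Φ Ψ : ℕ → ℝ} (h : ∀ b : ℕ, 1 ≤ b → (b : ℝ) ≤ R ^ j → |Φ b| ≤ Ψ b) :
    |(mulSum s ^ j) Φ 1| ≤ (mulSum s ^ j) Ψ 1 := by
  induction j generalizing Φ Ψ with
  | zero => simpa using h 1 le_rfl (by simp)
  | succ j ih =>
    rw [mulSum_pow_succ_one, mulSum_pow_succ_one]
    refine (Finset.abs_sum_le_sum_abs _ _).trans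
      (Finset.sum_le_sum fun x hx => ih fun b hb hbR => ?_)
    obtain ⟨hx1, hxR⟩ := hs x hx
    refine h _ (Nat.mul_pos hx1 hb) ?_
    push_cast
    rw [pow_succ']
    exact mul_le_mul hxR hbR (by positivity) (le_trans (by positivity) hxR)

lemma mulSum_pow_const_mul (s : Finset ℕ) (j : ℕ) (c : ℝ) (Φ : ℕ → ℝ) :
    (mulSum s ^ j) (fun n => c * Φ n) 1 = c * (mulSum s ^ j) Φ 1 := by
  have : (fun n => c * Φ n) = c • Φ := rfl
  rw [this, map_smul]; rfl

lemma mulSum_pow_sub (s : Finset ℕ) (j : ℕ) (Φ Ψ : ℕ → ℝ) :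
    (mulSum s ^ j) (fun n => Φ n - Ψ n) 1 = (mulSum s ^ j) Φ 1 - (mulSum s ^ j) Ψ 1 := by
  have : (fun n => Φ n - Ψ n) = Φ - Ψ := rfl
  rw [this, map_sub]; rfl

lemma mulSum_pow_inv (s : Finset ℕ) (j : ℕ) :
    (mulSum s ^ j) (fun n => (n : ℝ)⁻¹) 1 = (∑ x ∈ s, (x : ℝ)⁻¹) ^ j := by
  induction j with
  | zero => simp
  | succ j ih =>
    rw [mulSum_pow_succ_one, pow_succ', Finset.sum_mul]
    refine Finset.sum_congr rfl fun x _ => ?_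
    simp only [Nat.cast_mul, mul_inv]
    rw [mulSum_pow_const_mul, ih]

lemma abs_mulSum_pow_le {s : Finset ℕ} {R K : ℝ} (hs : ∀ x ∈ s, 1 ≤ x ∧ (x : ℝ) ≤ R)
    (j : ℕ) {Φ : ℕ → ℝ} (h : ∀ b : ℕ, 1 ≤ b → (b : ℝ) ≤ R ^ j → |Φ b| ≤ K * (b : ℝ)⁻¹) :
    |(mulSum s ^ j) Φ 1| ≤ K * (∑ x ∈ s, (x : ℝ)⁻¹) ^ j := by
  rw [← mulSum_pow_inv, ← mulSum_pow_const_mul]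
  exact abs_mulSum_pow_le_of_le hs j h

/-- The function `∫_1^s (log t)^{l-1}/(l-1)! dt` (with value `1` for `l = 0`), given by its
integration-by-parts recursion. -/
noncomputable def hypVol : ℕ → ℝ → ℝ
  | 0, _ => 1
  | l + 1, s => s * Real.log s ^ l / (Nat.factorial l : ℝ) - hypVol l s

lemma hasDerivAt_hypVol (l : ℕ) {s : ℝ} (hs : 0 < s) :
    HasDerivAt (hypVol (l + 1)) (Real.log s ^ l / (Nat.factorial l : ℝ)) s := by
  induction l with
  | zero =>
    have : hypVol 1 = fun s => s - 1 := by ext s; simp [hypVol]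
    rw [show (0 + 1) = 1 from rfl, this]
    simpa using (hasDerivAt_id s).sub_const 1
  | succ l ih =>
    have h1 : HasDerivAt (fun s => s * Real.log s ^ (l + 1) / (Nat.factorial (l + 1) : ℝ))
        ((1 * Real.log s ^ (l + 1) + s * (((l + 1 : ℕ) : ℝ) * Real.log s ^ l * s⁻¹)) /
          (Nat.factorial (l + 1) : ℝ)) s :=
      ((hasDerivAt_id s).mul ((Real.hasDerivAt_log hs.ne').pow (l + 1))).div_const _
    have h2 := h1.sub ih
    have h3 : hypVol (l + 1 + 1) =
        (fun s => s * Real.log s ^ (l + 1) / (Nat.factorial (l + 1) : ℝ)) - hypVol (l + 1) := by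
      ext s; simp [hypVol]
    rw [h3]
    refine h2.congr_deriv ?_
    rw [Nat.factorial_succ]
    have : (Nat.factorial l : ℝ) ≠ 0 := by positivity
    push_cast
    field_simp
    ring

lemma hypVol_succ_one (l : ℕ) : hypVol (l + 1) 1 = 0 := by
  induction l with
  | zero => simp [hypVol]
  | succ l ih => rw [hypVol, ih]; simp

lemma monotoneOn_hypVol (l : ℕ) : MonotoneOn (hypVol l) (Set.Ici 1) := by
  cases l with
  | zero => intro x _ y _ _; simp [hypVol]
  | succ l =>
    refine monotoneOn_of_deriv_nonneg (convex_Ici 1) ?_ ?_ ?_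
    · intro s hs
      exact (hasDerivAt_hypVol l (zero_lt_one.trans_le hs)).continuousAt.continuousWithinAt
    · intro s hs
      rw [interior_Ici] at hs
      exact (hasDerivAt_hypVol l (zero_lt_one.trans hs)).differentiableAt.differentiableWithinAt
    · intro s hs
      rw [interior_Ici] at hs
      rw [(hasDerivAt_hypVol l (zero_lt_one.trans hs)).deriv]
      have := Real.log_nonneg (le_of_lt hs)
      positivity

lemma hypVol_nonneg (l : ℕ) {s : ℝ} (hs : 1 ≤ s) : 0 ≤ hypVol l s := by
  cases l with
  | zero => simp [hypVol]
  | succ l =>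
    rw [← hypVol_succ_one l]
    exact monotoneOn_hypVol (l + 1) (Set.mem_Ici.2 le_rfl) hs hs

lemma hasDerivAt_mul_hypVol_div (l : ℕ) {s x : ℝ} (hs : 0 < s) (hx : 0 < x) :
    HasDerivAt (fun x => x * hypVol (l + 1) (s / x)) (-hypVol l (s / x)) x := by
  have h1 : HasDerivAt (fun x : ℝ => s / x) (s * (-(x ^ 2)⁻¹)) x := by
    simpa [div_eq_mul_inv] using (hasDerivAt_inv hx.ne').const_mul s
  have h2 := (hasDerivAt_id x).mul ((hasDerivAt_hypVol l (div_pos hs hx)).comp x h1)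
  refine h2.congr_deriv ?_
  simp only [hypVol, id, Function.comp]
  field_simp
  ring

/-- `hypVol`, extended by zero to `s < 1`. -/
noncomputable def hypVolPos (l : ℕ) (s : ℝ) : ℝ := if 1 ≤ s then hypVol l s else 0

lemma hypVolPos_nonneg (l : ℕ) (s : ℝ) : 0 ≤ hypVolPos l s := by
  unfold hypVolPos
  split_ifs with h
  · exact hypVol_nonneg l h
  · exact le_rfl

lemma hypVolPos_mono (l : ℕ) : Monotone (hypVolPos l) := by
  intro a b hab
  by_cases ha : 1 ≤ a
  · have hb := ha.trans hab
    simp only [hypVolPos, ha, hb, if_true]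
    exact monotoneOn_hypVol l ha hb hab
  · rw [hypVolPos, if_neg ha]
    exact hypVolPos_nonneg l b

lemma hypVolPos_succ_of_le_one (l : ℕ) {s : ℝ} (hs : s ≤ 1) : hypVolPos (l + 1) s = 0 := by
  rcases hs.lt_or_eq with h | h
  · rw [hypVolPos, if_neg (not_le.2 h)]
  · rw [h, hypVolPos, if_pos le_rfl, hypVol_succ_one]

lemma mul_hypVolPos_sub_of_le (l : ℕ) {s x y : ℝ} (hx : 0 < x) (hxy : x ≤ y) (hys : y ≤ s) :
    (y - x) * hypVolPos l (s / y) ≤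
        x * hypVolPos (l + 1) (s / x) - y * hypVolPos (l + 1) (s / y) ∧
      x * hypVolPos (l + 1) (s / x) - y * hypVolPos (l + 1) (s / y) ≤
        (y - x) * hypVolPos l (s / x) := by
  have hs : 0 < s := hx.trans_le (hxy.trans hys)
  have hy : 0 < y := hx.trans_le hxy
  rcases hxy.eq_or_lt with rfl | hlt
  · simp
  obtain ⟨c, ⟨hxc, hcy⟩, hc⟩ := exists_hasDerivAt_eq_slope
    (fun x => x * hypVol (l + 1) (s / x)) (fun x => -hypVol l (s / x)) hlt
    (fun z hz => (hasDerivAt_mul_hypVol_div l hs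
      (hx.trans_le hz.1)).continuousAt.continuousWithinAt)
    (fun z hz => hasDerivAt_mul_hypVol_div l hs (hx.trans hz.1))
  have hc0 : 0 < c := hx.trans hxc
  have h1x : 1 ≤ s / x := by rw [le_div_iff₀ hx]; linarith
  have h1y : 1 ≤ s / y := by rw [le_div_iff₀ hy]; linarith
  have h1c : 1 ≤ s / c := by rw [le_div_iff₀ hc0]; linarith
  simp only [hypVolPos, h1x, h1y, if_true]
  have hm1 : hypVol l (s / y) ≤ hypVol l (s / c) := monotoneOn_hypVol l h1y h1c (by gcongr)
  have hm2 : hypVol l (s / c) ≤ hypVol l (s / x) := monotoneOn_hypVol l h1c h1x (by gcongr)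
  rw [eq_div_iff (by linarith)] at hc
  have hd : 0 < y - x := by linarith
  constructor <;> nlinarith

lemma mul_hypVolPos_sub (l : ℕ) {s x y : ℝ} (hx : 0 < x) (hxy : x ≤ y) :
    (y - x) * hypVolPos l (s / y) ≤
        x * hypVolPos (l + 1) (s / x) - y * hypVolPos (l + 1) (s / y) ∧
      x * hypVolPos (l + 1) (s / x) - y * hypVolPos (l + 1) (s / y) ≤
        (y - x) * hypVolPos l (s / x) := by
  have hy : 0 < y := hx.trans_le hxy
  rcases le_or_gt y s with hys | hys
  · exact mul_hypVolPos_sub_of_le l hx hxy hys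
  have h1 : s / y < 1 := by rwa [div_lt_one hy]
  rw [hypVolPos_succ_of_le_one l h1.le]
  have h2 : hypVolPos l (s / y) = 0 := by rw [hypVolPos, if_neg (not_le.2 h1)]
  rw [h2]
  rcases le_or_gt x s with hxs | hxs
  · have h3 := (mul_hypVolPos_sub_of_le l hx hxs le_rfl).2
    rw [div_self (by linarith), hypVolPos_succ_of_le_one l le_rfl] at h3
    have h4 := hypVolPos_nonneg l (s / x)
    have h5 := hypVolPos_nonneg (l + 1) (s / x)
    constructor
    · have := mul_nonneg hx.le h5
      linarith
    · nlinarith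
  · have h3 : s / x < 1 := by rwa [div_lt_one hx]
    rw [hypVolPos_succ_of_le_one l h3.le, hypVolPos, if_neg (not_le.2 h3)]
    simp

/-- The volume of `{x ∈ (R, ∞)^l : x₁ ⋯ x_l ≤ T}`. -/
noncomputable def boxVol (R : ℝ) (l : ℕ) (T : ℝ) : ℝ := R ^ l * hypVolPos l (T / R ^ l)

lemma boxVol_nonneg {R : ℝ} (hR : 0 < R) (l : ℕ) (T : ℝ) : 0 ≤ boxVol R l T :=
  mul_nonneg (by positivity) (hypVolPos_nonneg _ _)

lemma boxVol_mono {R : ℝ} (hR : 0 < R) (l : ℕ) : Monotone (boxVol R l) := by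
  intro a b hab
  unfold boxVol
  have := hypVolPos_mono l (show a / R ^ l ≤ b / R ^ l by gcongr)
  gcongr

/-- The volume of `{x ∈ (y, ∞) × (R, ∞)^l : x₀ ⋯ x_l ≤ T}`. -/
noncomputable def boxTail (R : ℝ) (l : ℕ) (T y : ℝ) : ℝ :=
  R ^ l * (y * hypVolPos (l + 1) (T / R ^ l / y))

lemma boxTail_self {R : ℝ} (l : ℕ) (T : ℝ) :
    boxTail R l T R = boxVol R (l + 1) T := by
  rw [boxTail, boxVol, pow_succ, div_div, mul_assoc]

lemma boxTail_sub {R : ℝ} (hR : 0 < R) (l : ℕ) (T : ℝ) {x y : ℝ} (hx : 0 < x) (hxy : x ≤ y) :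
    (y - x) * boxVol R l (T / y) ≤ boxTail R l T x - boxTail R l T y ∧
      boxTail R l T x - boxTail R l T y ≤ (y - x) * boxVol R l (T / x) := by
  obtain ⟨h1, h2⟩ := mul_hypVolPos_sub l (s := T / R ^ l) hx hxy
  unfold boxTail boxVol
  have hRl : 0 ≤ R ^ l := by positivity
  rw [div_right_comm T y, div_right_comm T x]
  constructor
  · nlinarith [mul_le_mul_of_nonneg_left h1 hRl]
  · nlinarith [mul_le_mul_of_nonneg_left h2 hRl]

lemma boxTail_anti {R : ℝ} (hR : 0 < R) (l : ℕ) (T : ℝ) {x y : ℝ} (hx : 0 < x) (hxy : x ≤ y) :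
    boxTail R l T y ≤ boxTail R l T x := by
  have h1 := (boxTail_sub hR l T hx hxy).1
  have h2 := boxVol_nonneg hR l (T / y)
  nlinarith [mul_nonneg (sub_nonneg.2 hxy) h2]

lemma boxTail_nonneg {R : ℝ} (hR : 0 < R) (l : ℕ) (T : ℝ) {x : ℝ} (hx : 0 < x) :
    0 ≤ boxTail R l T x :=
  mul_nonneg (by positivity) (mul_nonneg hx.le (hypVolPos_nonneg _ _))

lemma boxTail_eq_zero {R : ℝ} (hR : 0 < R) (l : ℕ) {T x : ℝ} (hx : 0 < x)
    (h : T ≤ R ^ l * x) : boxTail R l T x = 0 := by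
  rw [boxTail, hypVolPos_succ_of_le_one, mul_zero, mul_zero]
  rw [div_div, div_le_one (by positivity)]
  exact h

lemma hypVolPos_succ_sub_le (p : ℕ) {a b : ℝ} (hab : a ≤ b) (hb : 1 ≤ b) :
    hypVolPos (p + 1) b - hypVolPos (p + 1) a ≤
      (b - a) * (Real.log b ^ p / (Nat.factorial p : ℝ)) := by
  have key : ∀ a, 1 ≤ a → a ≤ b → hypVolPos (p + 1) b - hypVolPos (p + 1) a ≤
      (b - a) * (Real.log b ^ p / (Nat.factorial p : ℝ)) := by
    intro a ha hab
    rcases hab.eq_or_lt with rfl | hlt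
    · simp
    obtain ⟨c, ⟨hac, hcb⟩, hc⟩ := exists_hasDerivAt_eq_slope (hypVol (p + 1))
      (fun x => Real.log x ^ p / (Nat.factorial p : ℝ)) hlt
      (fun z hz => (hasDerivAt_hypVol p (by linarith [hz.1])).continuousAt.continuousWithinAt)
      (fun z hz => hasDerivAt_hypVol p (by linarith [hz.1]))
    rw [eq_div_iff (by linarith)] at hc
    simp only [hypVolPos, ha, hb, if_true]
    rw [← hc, mul_comm]
    have h0 : 0 ≤ Real.log c := Real.log_nonneg (by linarith)
    have h1 : Real.log c ≤ Real.log b := Real.log_le_log (by linarith) hcb.le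
    gcongr
  rcases le_or_gt 1 a with ha | ha
  · exact key a ha hab
  · have h1 := key 1 le_rfl hb
    rw [hypVolPos_succ_of_le_one p le_rfl] at h1
    rw [hypVolPos_succ_of_le_one p ha.le]
    refine h1.trans ?_
    have := Real.log_nonneg hb
    gcongr

lemma le_hypVolPos_succ_sub (p : ℕ) {a b : ℝ} (ha : 1 ≤ a) (hab : a ≤ b) :
    (b - a) * (Real.log a ^ p / (Nat.factorial p : ℝ)) ≤
      hypVolPos (p + 1) b - hypVolPos (p + 1) a := by
  rcases hab.eq_or_lt with rfl | hlt
  · simp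
  obtain ⟨c, ⟨hac, hcb⟩, hc⟩ := exists_hasDerivAt_eq_slope (hypVol (p + 1))
    (fun x => Real.log x ^ p / (Nat.factorial p : ℝ)) hlt
    (fun z hz => (hasDerivAt_hypVol p (by linarith [hz.1])).continuousAt.continuousWithinAt)
    (fun z hz => hasDerivAt_hypVol p (by linarith [hz.1]))
  rw [eq_div_iff (by linarith)] at hc
  simp only [hypVolPos, ha, ha.trans hab, if_true]
  rw [← hc, mul_comm]
  have h0 : 0 ≤ Real.log a := Real.log_nonneg (by linarith)
  have h1 : Real.log a ≤ Real.log c := Real.log_le_log (by linarith) hac.le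
  gcongr

lemma boxVol_succ_sub_le {R : ℝ} (hR : 0 < R) (p : ℕ) {a b : ℝ} (hab : a ≤ b)
    (hb : R ^ (p + 1) ≤ b) :
    boxVol R (p + 1) b - boxVol R (p + 1) a ≤
      (b - a) * (Real.log (b / R ^ (p + 1)) ^ p / (Nat.factorial p : ℝ)) := by
  have hR' : 0 < R ^ (p + 1) := by positivity
  have h := hypVolPos_succ_sub_le p (a := a / R ^ (p + 1)) (b := b / R ^ (p + 1)) (by gcongr)
    (by rwa [one_le_div hR'])
  have h2 := mul_le_mul_of_nonneg_left h hR'.le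
  unfold boxVol
  rw [← mul_sub]
  refine h2.trans_eq ?_
  field_simp

lemma le_boxVol_succ_sub {R : ℝ} (hR : 0 < R) (p : ℕ) {a b : ℝ} (ha : R ^ (p + 1) ≤ a)
    (hab : a ≤ b) :
    (b - a) * (Real.log (a / R ^ (p + 1)) ^ p / (Nat.factorial p : ℝ)) ≤
      boxVol R (p + 1) b - boxVol R (p + 1) a := by
  have hR' : 0 < R ^ (p + 1) := by positivity
  have h := le_hypVolPos_succ_sub p (a := a / R ^ (p + 1)) (b := b / R ^ (p + 1))
    (by rwa [one_le_div hR']) (by gcongr)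
  have h2 := mul_le_mul_of_nonneg_left h hR'.le
  unfold boxVol
  rw [← mul_sub]
  refine le_trans (Eq.le ?_) h2
  field_simp

lemma sum_Ioc_add_one_shift (f : ℕ → ℝ) (M q : ℕ) :
    ∑ n ∈ Finset.Ioc (M + 1) (M + 1 + q), f n =
      ∑ n ∈ Finset.Ioc M (M + q), f n + f (M + 1 + q) - f (M + 1) := by
  have h1 := Finset.sum_Ioc_consecutive f (show M ≤ M + 1 by omega)
    (show M + 1 ≤ M + 1 + q by omega)
  have h2 : ∑ n ∈ Finset.Ioc M (M + q + 1), f n = _ :=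
    Finset.sum_Ioc_succ_top (show M ≤ M + q by omega) f
  rw [show M + q + 1 = M + 1 + q by omega] at h2
  have h3 : ∑ n ∈ Finset.Ioc M (M + 1), f n = f (M + 1) := by simp
  linarith

lemma sum_Ioc_of_periodic {ψ : ℕ → ℝ} {q : ℕ} (hψ : Function.Periodic ψ q) (M : ℕ) :
    ∑ n ∈ Finset.Ioc M (M + q), ψ n = ∑ n ∈ Finset.range q, ψ n := by
  induction M with
  | zero =>
    rw [Finset.range_eq_Ico]
    have h1 := Finset.sum_Ioc_succ_top (show 0 ≤ q by omega) ψ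
    have h2 := Finset.sum_range_succ ψ q
    have h3 := Finset.sum_range_succ' ψ q
    have h4 : ψ q = ψ 0 := by simpa using hψ 0
    have h5 : ∑ n ∈ Finset.Ioc 0 (0 + q), ψ n = ∑ k ∈ Finset.range q, ψ (k + 1) := by
      rw [Finset.range_eq_Ico, Finset.sum_Ico_add' ψ 0 q 1]
      refine Finset.sum_congr ?_ fun _ _ => rfl
      ext n; simp only [Finset.mem_Ioc, Finset.mem_Ico]; omega
    rw [← Finset.range_eq_Ico]
    linarith
  | succ M ih =>
    rw [sum_Ioc_add_one_shift, ih, hψ (M + 1)]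
    ring

/-- Telescoping with step `q` against a `q`-periodic weight. -/
lemma sum_Ioc_periodic_mul_sub {ψ : ℕ → ℝ} {q : ℕ} (hψ : Function.Periodic ψ q) (H : ℕ → ℝ)
    {M₀ M : ℕ} (hM : M₀ ≤ M) :
    ∑ n ∈ Finset.Ioc M₀ M, ψ n * (H n - H (n + q)) =
      ∑ n ∈ Finset.Ioc M₀ (M₀ + q), ψ n * H n - ∑ n ∈ Finset.Ioc M (M + q), ψ n * H n := by
  induction M, hM using Nat.le_induction with
  | base => simp
  | succ M hM ih =>
    rw [Finset.sum_Ioc_succ_top hM, ih, sum_Ioc_add_one_shift (fun n => ψ n * H n)]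
    simp only [hψ (M + 1)]
    ring

lemma sum_periodic_mul_le {ψ : ℕ → ℝ} {q : ℕ} (hψ : Function.Periodic ψ q) (hψ0 : ∀ n, 0 ≤ ψ n)
    (h H : ℕ → ℝ) {M₀ M : ℕ} (hM : M₀ ≤ M) {B C : ℝ}
    (hh : ∀ n ∈ Finset.Ioc M₀ M, q * h n ≤ H n - H (n + q))
    (hB : ∀ n ∈ Finset.Ioc M₀ (M₀ + q), H n ≤ B)
    (hC : ∀ n ∈ Finset.Ioc M (M + q), C ≤ H n) :
    q * ∑ n ∈ Finset.Ioc M₀ M, ψ n * h n ≤ (∑ r ∈ Finset.range q, ψ r) * (B - C) := by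
  calc q * ∑ n ∈ Finset.Ioc M₀ M, ψ n * h n
      = ∑ n ∈ Finset.Ioc M₀ M, ψ n * (q * h n) := by
        rw [Finset.mul_sum]; exact Finset.sum_congr rfl fun _ _ => by ring
    _ ≤ ∑ n ∈ Finset.Ioc M₀ M, ψ n * (H n - H (n + q)) :=
        Finset.sum_le_sum fun n hn => mul_le_mul_of_nonneg_left (hh n hn) (hψ0 n)
    _ = _ := sum_Ioc_periodic_mul_sub hψ H hM
    _ ≤ ∑ n ∈ Finset.Ioc M₀ (M₀ + q), ψ n * B - ∑ n ∈ Finset.Ioc M (M + q), ψ n * C :=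
        sub_le_sub
          (Finset.sum_le_sum fun n hn => mul_le_mul_of_nonneg_left (hB n hn) (hψ0 n))
          (Finset.sum_le_sum fun n hn => mul_le_mul_of_nonneg_left (hC n hn) (hψ0 n))
    _ = _ := by
        rw [← Finset.sum_mul, ← Finset.sum_mul, sum_Ioc_of_periodic hψ, sum_Ioc_of_periodic hψ]
        ring

lemma le_sum_periodic_mul {ψ : ℕ → ℝ} {q : ℕ} (hψ : Function.Periodic ψ q) (hψ0 : ∀ n, 0 ≤ ψ n)
    (h H : ℕ → ℝ) {M₀ M : ℕ} (hM : M₀ ≤ M) {B C : ℝ}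
    (hh : ∀ n ∈ Finset.Ioc M₀ M, H n - H (n + q) ≤ q * h n)
    (hB : ∀ n ∈ Finset.Ioc M₀ (M₀ + q), B ≤ H n)
    (hC : ∀ n ∈ Finset.Ioc M (M + q), H n ≤ C) :
    (∑ r ∈ Finset.range q, ψ r) * (B - C) ≤ q * ∑ n ∈ Finset.Ioc M₀ M, ψ n * h n := by
  have := sum_periodic_mul_le hψ hψ0 (fun n => -h n) (fun n => -H n) hM (B := -B) (C := -C)
    (fun n hn => by linarith [hh n hn]) (fun n hn => by linarith [hB n hn])
    (fun n hn => by linarith [hC n hn])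
  simp only [mul_neg, Finset.sum_neg_distrib] at this
  linarith

/-- The sum of `φ (r₁ ⋯ r_l)` over all residues `r₁, …, r_l` modulo `q`. -/
def resSum (q : ℕ) : ℕ → (ℕ → ℝ) → ℝ
  | 0, φ => φ 1
  | l + 1, φ => ∑ r ∈ Finset.range q, resSum q l (fun m => φ (r * m))

lemma resSum_nonneg (q l : ℕ) {φ : ℕ → ℝ} (hφ : ∀ n, 0 ≤ φ n) : 0 ≤ resSum q l φ := by
  induction l generalizing φ with
  | zero => exact hφ 1
  | succ l ih => exact Finset.sum_nonneg fun r _ => ih fun m => hφ _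

lemma resSum_le (q l : ℕ) {φ : ℕ → ℝ} (hφ : ∀ n, φ n ≤ 1) : resSum q l φ ≤ (q : ℝ) ^ l := by
  induction l generalizing φ with
  | zero => simpa [resSum] using hφ 1
  | succ l ih =>
    calc resSum q (l + 1) φ ≤ ∑ r ∈ Finset.range q, (q : ℝ) ^ l :=
          Finset.sum_le_sum fun r _ => ih fun m => hφ _
      _ = _ := by simp [pow_succ']

lemma Function.Periodic.comp_nat_mul {φ : ℕ → ℝ} {q : ℕ} (hφ : Function.Periodic φ q) (x : ℕ) :
    Function.Periodic (fun m => φ (x * m)) q := by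
  intro m
  have := hφ.nat_mul x (x * m)
  simp only [Nat.cast_id] at this
  simp only [mul_add, this]

lemma periodic_resSum {φ : ℕ → ℝ} {q : ℕ} (hφ : Function.Periodic φ q) (l : ℕ) :
    Function.Periodic (fun n => resSum q l (fun m => φ (n * m))) q := by
  intro n
  have : (fun m => φ ((n + q) * m)) = fun m => φ (n * m) := by
    ext m
    have := hφ.nat_mul m (n * m)
    simp only [Nat.cast_id] at this
    rw [add_mul, mul_comm q m, this]
  simp only [this]

lemma mulSum_pow_congr (s : Finset ℕ) (l : ℕ) {Φ Ψ : ℕ → ℝ} (h : ∀ n, Φ n = Ψ n) :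
    (mulSum s ^ l) Φ 1 = (mulSum s ^ l) Ψ 1 := by
  rw [show Φ = Ψ from funext h]

lemma mulSum_cumul_succ (R T : ℝ) (N l : ℕ) (φ : ℕ → ℝ) :
    (mulSum (Finset.Ioc ⌊R⌋₊ N) ^ (l + 1)) (fun n => φ n * if (n : ℝ) ≤ T then 1 else 0) 1 =
      ∑ x ∈ Finset.Ioc ⌊R⌋₊ N, (mulSum (Finset.Ioc ⌊R⌋₊ N) ^ l)
        (fun n => φ (x * n) * if (n : ℝ) ≤ T / x then 1 else 0) 1 := by
  rw [mulSum_pow_succ_one]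
  refine Finset.sum_congr rfl fun x hx => mulSum_pow_congr _ _ fun n => ?_
  have hx0 : (0 : ℝ) < x := by
    exact_mod_cast (Nat.zero_le _).trans_lt (Finset.mem_Ioc.1 hx).1
  congr 2
  rw [le_div_iff₀ hx0, mul_comm (n : ℝ)]
  push_cast
  rfl

lemma pow_mul_mulSum_cumul_le {R : ℝ} (hR : 0 < R) (q N l : ℕ) (hN : R ≤ N)
    {φ : ℕ → ℝ} (hφ : Function.Periodic φ q) (hφ0 : ∀ n, 0 ≤ φ n) (T : ℝ) :
    (q : ℝ) ^ l * (mulSum (Finset.Ioc ⌊R⌋₊ N) ^ l)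
        (fun n => φ n * if (n : ℝ) ≤ T then 1 else 0) 1 ≤
      resSum q l φ * boxVol R l (T * (1 + q / R) ^ l) := by
  induction l generalizing φ T with
  | zero => simp [boxVol, hypVolPos, hypVol, resSum]
  | succ l ih =>
    set κ : ℝ := 1 + q / R with hκ
    have hκ1 : 1 ≤ κ := by rw [hκ]; linarith [show (0 : ℝ) ≤ q / R by positivity]
    rw [mulSum_cumul_succ, pow_succ', mul_assoc, Finset.mul_sum]
    have h1 : ∀ x ∈ Finset.Ioc ⌊R⌋₊ N, (q : ℝ) ^ l * (mulSum (Finset.Ioc ⌊R⌋₊ N) ^ l)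
        (fun n => φ (x * n) * if (n : ℝ) ≤ T / x then 1 else 0) 1 ≤
        resSum q l (fun m => φ (x * m)) * boxVol R l (T / x * κ ^ l) := fun x _ =>
      ih (hφ.comp_nat_mul x) (fun n => hφ0 _) (T / x)
    refine (mul_le_mul_of_nonneg_left (Finset.sum_le_sum h1) (Nat.cast_nonneg q)).trans ?_
    refine (sum_periodic_mul_le (periodic_resSum hφ l)
      (fun n => resSum_nonneg q l fun m => hφ0 _) (fun x => boxVol R l (T / x * κ ^ l))
      (fun x => boxTail R l (T * κ ^ (l + 1)) x) (Nat.floor_le_of_le hN)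
      (B := boxTail R l (T * κ ^ (l + 1)) R) (C := 0) ?_ ?_ ?_).trans_eq ?_
    · intro x hx
      have hxR : R < x := Nat.lt_of_floor_lt (Finset.mem_Ioc.1 hx).1
      have hx0 : (0 : ℝ) < x := hR.trans hxR
      have hb := (boxTail_sub hR l (T * κ ^ (l + 1)) hx0
        (show (x : ℝ) ≤ ((x + q : ℕ) : ℝ) by push_cast; linarith [Nat.cast_nonneg (α := ℝ) q])).1
      refine le_trans ?_ hb
      push_cast
      rw [add_sub_cancel_left]
      rcases lt_or_ge T 0 with hT | hT
      · have hz : ∀ T' : ℝ, T' < 0 → boxVol R l T' = 0 := by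
          intro T' hT'
          rw [boxVol, hypVolPos, if_neg, mul_zero]
          have := div_neg_of_neg_of_pos hT' (show 0 < R ^ l by positivity)
          linarith
        rw [hz, hz]
        · exact div_neg_of_neg_of_pos (mul_neg_of_neg_of_pos hT (by positivity)) (by positivity)
        · exact mul_neg_of_neg_of_pos (div_neg_of_neg_of_pos hT hx0) (by positivity)
      refine mul_le_mul_of_nonneg_left (boxVol_mono hR l ?_) (Nat.cast_nonneg q)
      have h1 : 1 ≤ x / R := by rw [one_le_div hR]; exact hxR.le
      have h2 : (x : ℝ) + q ≤ κ * x := by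
        rw [hκ, add_mul, one_mul, div_mul_eq_mul_div, mul_div_assoc]
        nlinarith [Nat.cast_nonneg (α := ℝ) q]
      rw [div_mul_eq_mul_div, div_le_div_iff₀ hx0 (by positivity)]
      calc T * κ ^ l * (x + q) ≤ T * κ ^ l * (κ * x) := by gcongr
        _ = _ := by ring
    · intro x hx
      have hxR : R < x := Nat.lt_of_floor_lt (Finset.mem_Ioc.1 hx).1
      exact boxTail_anti hR l _ hR hxR.le
    · intro x hx
      have hx0 : (0 : ℝ) < x := by exact_mod_cast (Nat.zero_le _).trans_lt (Finset.mem_Ioc.1 hx).1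
      exact boxTail_nonneg hR l _ hx0
    · rw [sub_zero, boxTail_self]
      rfl

lemma le_pow_mul_mulSum_cumul {R : ℝ} (hR : 1 ≤ R) (q N l : ℕ) (hN : R ≤ N)
    {φ : ℕ → ℝ} (hφ : Function.Periodic φ q) (hφ0 : ∀ n, 0 ≤ φ n) {T : ℝ} (hT : 0 ≤ T)
    (hTN : T + q ≤ N) :
    resSum q l φ * boxVol R l (T / (1 + q / R) ^ l) ≤
      (q : ℝ) ^ l * (mulSum (Finset.Ioc ⌊R⌋₊ N) ^ l)
        (fun n => φ n * if (n : ℝ) ≤ T then 1 else 0) 1 := by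
  have hR0 : 0 < R := by linarith
  induction l generalizing φ T with
  | zero => simp [boxVol, hypVolPos, hypVol, resSum]
  | succ l ih =>
    set κ : ℝ := 1 + q / R with hκ
    have hκ1 : 1 ≤ κ := by rw [hκ]; linarith [show (0 : ℝ) ≤ q / R by positivity]
    have hκ0 : 0 < κ := by linarith
    rw [mulSum_cumul_succ, pow_succ' (q : ℝ), mul_assoc, Finset.mul_sum]
    have h1 : ∀ x ∈ Finset.Ioc ⌊R⌋₊ N,
        resSum q l (fun m => φ (x * m)) * boxVol R l (T / x / κ ^ l) ≤
        (q : ℝ) ^ l * (mulSum (Finset.Ioc ⌊R⌋₊ N) ^ l)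
        (fun n => φ (x * n) * if (n : ℝ) ≤ T / x then 1 else 0) 1 := by
      intro x hx
      have hxR : R < x := Nat.lt_of_floor_lt (Finset.mem_Ioc.1 hx).1
      refine ih (hφ.comp_nat_mul x) (fun n => hφ0 _) (by positivity) ?_
      have : T / x ≤ T := div_le_self hT (by linarith)
      linarith
    refine le_trans ?_ (mul_le_mul_of_nonneg_left (Finset.sum_le_sum h1) (Nat.cast_nonneg q))
    set T' := T / κ ^ (l + 1) with hT'
    have hT'T : T' ≤ T := div_le_self hT (one_le_pow₀ hκ1)
    refine le_trans (Eq.le ?_) (le_sum_periodic_mul (periodic_resSum hφ l)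
      (fun n => resSum_nonneg q l fun m => hφ0 _) (fun x => boxVol R l (T / x / κ ^ l))
      (fun x => boxTail R l T' (max ((x : ℝ) - q) R)) (Nat.floor_le_of_le hN)
      (B := boxTail R l T' R) (C := 0) ?_ ?_ ?_)
    · rw [sub_zero, boxTail_self]
      rfl
    · intro x hx
      have hxR : R < x := Nat.lt_of_floor_lt (Finset.mem_Ioc.1 hx).1
      have hx0 : (0 : ℝ) < x := hR0.trans hxR
      push_cast
      rw [add_sub_cancel_right, max_eq_left hxR.le]
      set y := max ((x : ℝ) - q) R with hy
      have hyR : R ≤ y := le_max_right _ _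
      have hyx : y ≤ x := max_le (by linarith [Nat.cast_nonneg (α := ℝ) q]) hxR.le
      have hxy : (x : ℝ) - y ≤ q := by linarith [le_max_left ((x : ℝ) - q) R]
      have hy0 : 0 < y := by linarith
      refine (boxTail_sub hR0 l T' hy0 hyx).2.trans ?_
      refine mul_le_mul hxy (boxVol_mono hR0 l ?_) (boxVol_nonneg hR0 _ _) (Nat.cast_nonneg q)
      rw [hT', div_div, div_div, pow_succ]
      refine div_le_div_of_nonneg_left hT (by positivity) ?_
      rw [mul_assoc, mul_comm (x : ℝ)]
      refine mul_le_mul_of_nonneg_left ?_ (by positivity)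
      rw [hκ, add_mul, one_mul, div_mul_eq_mul_div, mul_div_assoc]
      have : 1 ≤ y / R := by rw [one_le_div hR0]; exact hyR
      nlinarith [Nat.cast_nonneg (α := ℝ) q]
    · intro x hx
      have : (x : ℝ) - q ≤ R := by
        have h2 : (x : ℝ) ≤ ⌊R⌋₊ + q := by exact_mod_cast (Finset.mem_Ioc.1 hx).2
        have h3 := Nat.floor_le hR0.le
        linarith
      rw [max_eq_right this]
    · intro x hx
      have h2 : (N : ℝ) < x := by exact_mod_cast (Finset.mem_Ioc.1 hx).1
      refine (boxTail_eq_zero hR0 l (lt_max_of_lt_right hR0) ?_).le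
      have h3 : T' ≤ max ((x : ℝ) - q) R := le_max_of_le_left (by linarith)
      have h4 : 1 ≤ R ^ l := one_le_pow₀ hR
      have h5 : 0 < max ((x : ℝ) - q) R := lt_max_of_lt_right hR0
      nlinarith

lemma abs_mul_sum_Ioc_periodic_sub_le {φ : ℕ → ℝ} {q : ℕ} (hφ : Function.Periodic φ q)
    (hφ0 : ∀ n, 0 ≤ φ n) {Y Z : ℝ} (hY : 0 ≤ Y) (hYZ : Y ≤ Z) :
    q * ∑ n ∈ Finset.Ioc ⌊Y⌋₊ ⌊Z⌋₊, φ n ≤ (∑ r ∈ Finset.range q, φ r) * (Z - Y + q) ∧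
    (∑ r ∈ Finset.range q, φ r) * (Z - Y - q) ≤ q * ∑ n ∈ Finset.Ioc ⌊Y⌋₊ ⌊Z⌋₊, φ n := by
  have hS : 0 ≤ ∑ r ∈ Finset.range q, φ r := Finset.sum_nonneg fun r _ => hφ0 r
  have hM := Nat.floor_le_floor hYZ
  have hZ : 0 ≤ Z := hY.trans hYZ
  have a1 := Nat.floor_le hY
  have a2 := Nat.lt_floor_add_one Y
  have a3 := Nat.floor_le hZ
  have a4 := Nat.lt_floor_add_one Z
  constructor
  · have h := sum_periodic_mul_le hφ hφ0 (fun _ => 1) (fun n => -(n : ℝ)) hM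
      (B := -(⌊Y⌋₊ + 1)) (C := -(⌊Z⌋₊ + q)) (fun n _ => by push_cast; linarith)
      (fun n hn => by
        have : ((⌊Y⌋₊ + 1 : ℕ) : ℝ) ≤ n := by exact_mod_cast (Finset.mem_Ioc.1 hn).1
        push_cast at this; linarith)
      (fun n hn => by
        have : (n : ℝ) ≤ ((⌊Z⌋₊ + q : ℕ) : ℝ) := by exact_mod_cast (Finset.mem_Ioc.1 hn).2
        push_cast at this; linarith)
    simp only [mul_one] at h
    refine h.trans (mul_le_mul_of_nonneg_left ?_ hS)
    linarith
  · have h := le_sum_periodic_mul hφ hφ0 (fun _ => 1) (fun n => -(n : ℝ)) hM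
      (B := -(⌊Y⌋₊ + q)) (C := -(⌊Z⌋₊ + 1)) (fun n _ => by push_cast; linarith)
      (fun n hn => by
        have : (n : ℝ) ≤ ((⌊Y⌋₊ + q : ℕ) : ℝ) := by exact_mod_cast (Finset.mem_Ioc.1 hn).2
        push_cast at this; linarith)
      (fun n hn => by
        have : ((⌊Z⌋₊ + 1 : ℕ) : ℝ) ≤ n := by exact_mod_cast (Finset.mem_Ioc.1 hn).1
        push_cast at this; linarith)
    simp only [mul_one] at h
    refine le_trans (mul_le_mul_of_nonneg_left ?_ hS) h
    linarith

lemma sum_periodic_div_le {ψ : ℕ → ℝ} {q : ℕ} (hψ : Function.Periodic ψ q)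
    (hψ0 : ∀ n, 0 ≤ ψ n) {R : ℝ} (hR : 1 ≤ R) :
    q * ∑ n ∈ Finset.Ioc ⌊R⌋₊ ⌊R ^ 2⌋₊, ψ n * (n : ℝ)⁻¹ ≤
      (∑ r ∈ Finset.range q, ψ r) * ((1 + q / R) * (Real.log R + q / R)) := by
  have hR0 : 0 < R := by linarith
  have hq : (0 : ℝ) ≤ q := Nat.cast_nonneg q
  have hS : 0 ≤ ∑ r ∈ Finset.range q, ψ r := Finset.sum_nonneg fun r _ => hψ0 r
  have hM : ⌊R⌋₊ ≤ ⌊R ^ 2⌋₊ := Nat.floor_le_floor (by nlinarith)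
  have hε : 0 ≤ q / R := by positivity
  have h := sum_periodic_mul_le hψ hψ0 (fun n => (n : ℝ)⁻¹)
      (fun n => -((1 + q / R) * Real.log n)) hM
      (B := -((1 + q / R) * Real.log R)) (C := -((1 + q / R) * Real.log (R ^ 2 + q))) ?_ ?_ ?_
  · refine h.trans (mul_le_mul_of_nonneg_left ?_ hS)
    have h2 : Real.log (R ^ 2 + q) ≤ 2 * Real.log R + q / R := by
      have : R ^ 2 + q = R ^ 2 * (1 + q / R ^ 2) := by field_simp
      rw [this, Real.log_mul (by positivity) (by positivity), Real.log_pow]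
      have h3 := Real.log_le_sub_one_of_pos (show 0 < 1 + q / R ^ 2 by positivity)
      have h4 : q / R ^ 2 ≤ q / R := div_le_div_of_nonneg_left hq hR0 (by nlinarith)
      push_cast
      linarith
    nlinarith
  · intro n hn
    have hnR : R < n := Nat.lt_of_floor_lt (Finset.mem_Ioc.1 hn).1
    have hn0 : (0 : ℝ) < n := by linarith
    push_cast
    have h1 : Real.log n - Real.log (n + q) ≤ n / (n + q) - 1 := by
      rw [← Real.log_div (by positivity) (by positivity)]
      exact Real.log_le_sub_one_of_pos (by positivity)
    have h2 : (n : ℝ) / (n + q) - 1 = -(q / (n + q)) := by field_simp; ring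
    have h3 : q * (n : ℝ)⁻¹ ≤ (1 + q / R) * (q / (n + q)) := by
      rw [← div_eq_mul_inv, mul_div_assoc', div_le_div_iff₀ hn0 (by positivity)]
      have h4 : 1 ≤ n / R := by rw [one_le_div hR0]; exact hnR.le
      have h5 : (1 + q / R) * q * n = q * (n + q * (n / R)) := by ring
      rw [h5]
      refine mul_le_mul_of_nonneg_left ?_ hq
      nlinarith
    have h6 : (1 + q / R) * (q / (n + q)) ≤ (1 + q / R) * (Real.log (n + q) - Real.log n) :=
      mul_le_mul_of_nonneg_left (by linarith) (by linarith)
    linarith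
  · intro n hn
    have hnR : R < n := Nat.lt_of_floor_lt (Finset.mem_Ioc.1 hn).1
    have := Real.log_le_log hR0 hnR.le
    simp only [neg_le_neg_iff]
    exact mul_le_mul_of_nonneg_left this (by linarith)
  · intro n hn
    have h1 : (n : ℝ) ≤ ((⌊R ^ 2⌋₊ + q : ℕ) : ℝ) := by exact_mod_cast (Finset.mem_Ioc.1 hn).2
    push_cast at h1
    have h2 := Nat.floor_le (show 0 ≤ R ^ 2 by positivity)
    have h3 : (0 : ℝ) < n := by exact_mod_cast (Nat.zero_le _).trans_lt (Finset.mem_Ioc.1 hn).1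
    have := Real.log_le_log h3 (show (n : ℝ) ≤ R ^ 2 + q by linarith)
    simp only [neg_le_neg_iff]
    exact mul_le_mul_of_nonneg_left this (by linarith)

lemma le_sum_periodic_div {ψ : ℕ → ℝ} {q : ℕ} (hψ : Function.Periodic ψ q)
    (hψ0 : ∀ n, 0 ≤ ψ n) {R : ℝ} (hR : 1 ≤ R) :
    (∑ r ∈ Finset.range q, ψ r) * max (Real.log R - q / R) 0 ≤
      q * ∑ n ∈ Finset.Ioc ⌊R⌋₊ ⌊R ^ 2⌋₊, ψ n * (n : ℝ)⁻¹ := by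
  have hR0 : 0 < R := by linarith
  have hq : (0 : ℝ) ≤ q := Nat.cast_nonneg q
  have hS : 0 ≤ ∑ r ∈ Finset.range q, ψ r := Finset.sum_nonneg fun r _ => hψ0 r
  have hM : ⌊R⌋₊ ≤ ⌊R ^ 2⌋₊ := Nat.floor_le_floor (by nlinarith)
  have hpos : 0 ≤ q * ∑ n ∈ Finset.Ioc ⌊R⌋₊ ⌊R ^ 2⌋₊, ψ n * (n : ℝ)⁻¹ :=
    mul_nonneg hq (Finset.sum_nonneg fun n _ => mul_nonneg (hψ0 n) (by positivity))
  rcases max_cases (Real.log R - q / R) 0 with ⟨he, -⟩ | ⟨he, -⟩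
  swap
  · rw [he, mul_zero]; exact hpos
  rw [he]
  have h := le_sum_periodic_mul hψ hψ0 (fun n => (n : ℝ)⁻¹)
      (fun n => -(Real.log n)) hM
      (B := -(Real.log (R + q))) (C := -(Real.log (R ^ 2))) ?_ ?_ ?_
  · refine le_trans (mul_le_mul_of_nonneg_left ?_ hS) h
    have h2 : Real.log (R + q) ≤ Real.log R + q / R := by
      have : R + q = R * (1 + q / R) := by field_simp
      rw [this, Real.log_mul (by positivity) (by positivity)]
      have h3 := Real.log_le_sub_one_of_pos (show 0 < 1 + q / R by positivity)
      linarith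
    rw [Real.log_pow]
    push_cast
    linarith
  · intro n hn
    have hn0 : (0 : ℝ) < n := by exact_mod_cast (Nat.zero_le _).trans_lt (Finset.mem_Ioc.1 hn).1
    push_cast
    have h1 : Real.log (n + q) - Real.log n ≤ (n + q) / n - 1 := by
      rw [← Real.log_div (by positivity) (by positivity)]
      exact Real.log_le_sub_one_of_pos (by positivity)
    have h2 : ((n : ℝ) + q) / n - 1 = q * (n : ℝ)⁻¹ := by field_simp; ring
    linarith
  · intro n hn
    have h1 : (n : ℝ) ≤ ((⌊R⌋₊ + q : ℕ) : ℝ) := by exact_mod_cast (Finset.mem_Ioc.1 hn).2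
    push_cast at h1
    have h2 := Nat.floor_le hR0.le
    have h3 : (0 : ℝ) < n := by exact_mod_cast (Nat.zero_le _).trans_lt (Finset.mem_Ioc.1 hn).1
    exact neg_le_neg (Real.log_le_log h3 (by linarith))
  · intro n hn
    have hnR : R ^ 2 < n := Nat.lt_of_floor_lt (Finset.mem_Ioc.1 hn).1
    exact neg_le_neg (Real.log_le_log (by positivity) hnR.le)

lemma sum_Ioc_periodic_le {ψ : ℕ → ℝ} {q : ℕ} (hq : 0 < q) (hψ : Function.Periodic ψ q)
    (hψ0 : ∀ n, 0 ≤ ψ n) {T : ℝ} (hT : 0 ≤ T) (M₀ : ℕ) :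
    ∑ n ∈ Finset.Ioc M₀ ⌊T⌋₊, ψ n ≤ (∑ r ∈ Finset.range q, ψ r) * T := by
  have hS : 0 ≤ ∑ r ∈ Finset.range q, ψ r := Finset.sum_nonneg fun r _ => hψ0 r
  calc ∑ n ∈ Finset.Ioc M₀ ⌊T⌋₊, ψ n
      ≤ ∑ n ∈ Finset.Ioc M₀ ⌊T⌋₊, ∑ r ∈ Finset.range q, ψ r := by
        refine Finset.sum_le_sum fun n _ => ?_
        rw [← hψ.map_mod_nat n]
        exact Finset.single_le_sum (f := ψ) (fun r _ => hψ0 r)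
          (Finset.mem_range.2 (Nat.mod_lt n hq))
    _ = (⌊T⌋₊ - M₀ : ℕ) * ∑ r ∈ Finset.range q, ψ r := by simp
    _ ≤ _ := by
        rw [mul_comm]
        refine mul_le_mul_of_nonneg_left ?_ hS
        exact le_trans (by exact_mod_cast Nat.sub_le _ _) (Nat.floor_le hT)

lemma mulSum_interval_succ (s : Finset ℕ) (hs : ∀ x ∈ s, 0 < x) (Y Z : ℝ) (N i : ℕ) (φ : ℕ → ℝ) :
    (mulSum s ^ (i + 1)) (fun c => ∑ y ∈ Finset.Icc 1 N, φ (c * y) *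
        if Y < ((c * y : ℕ) : ℝ) ∧ ((c * y : ℕ) : ℝ) ≤ Z then 1 else 0) 1 =
      ∑ x ∈ s, (mulSum s ^ i) (fun c => ∑ y ∈ Finset.Icc 1 N, φ (x * (c * y)) *
        if Y / x < ((c * y : ℕ) : ℝ) ∧ ((c * y : ℕ) : ℝ) ≤ Z / x then 1 else 0) 1 := by
  rw [mulSum_pow_succ_one]
  refine Finset.sum_congr rfl fun x hx => mulSum_pow_congr _ _ fun c =>
    Finset.sum_congr rfl fun y _ => ?_
  have hx0 : (0 : ℝ) < x := by exact_mod_cast hs x hx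
  have h : (((c * y : ℕ) : ℝ)) * x = ((x * c * y : ℕ) : ℝ) := by push_cast; ring
  simp only [le_div_iff₀ hx0, div_lt_iff₀ hx0, h, mul_assoc x]

lemma mulSum_interval_bounds {R : ℝ} (hR : 1 ≤ R) {q : ℕ} (hq : 0 < q) (N i : ℕ)
    {φ : ℕ → ℝ} (hφ : Function.Periodic φ q) (hφ0 : ∀ n, 0 ≤ φ n) {Y Z : ℝ} (hY : 0 ≤ Y)
    (hYZ : Y ≤ Z) (hZN : Z ≤ N) :
    (q : ℝ) ^ (i + 1) * (mulSum (Finset.Ioc ⌊R⌋₊ ⌊R ^ 2⌋₊) ^ i)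
        (fun c => ∑ y ∈ Finset.Icc 1 N, φ (c * y) *
          if Y < ((c * y : ℕ) : ℝ) ∧ ((c * y : ℕ) : ℝ) ≤ Z then 1 else 0) 1 ≤
      resSum q (i + 1) φ * ((Z - Y) * ((1 + q / R) * (Real.log R + q / R)) ^ i +
        q * (q * R ^ 2) ^ i) ∧
    resSum q (i + 1) φ * ((Z - Y) * (max (Real.log R - q / R) 0) ^ i - q * (q * R ^ 2) ^ i) ≤
      (q : ℝ) ^ (i + 1) * (mulSum (Finset.Ioc ⌊R⌋₊ ⌊R ^ 2⌋₊) ^ i)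
        (fun c => ∑ y ∈ Finset.Icc 1 N, φ (c * y) *
          if Y < ((c * y : ℕ) : ℝ) ∧ ((c * y : ℕ) : ℝ) ≤ Z then 1 else 0) 1 := by
  have hR0 : 0 < R := by linarith
  induction i generalizing φ Y Z with
  | zero =>
    have h1 : ∑ y ∈ Finset.Icc 1 N, φ y * (if Y < (y : ℝ) ∧ (y : ℝ) ≤ Z then (1 : ℝ) else 0) =
        ∑ n ∈ Finset.Ioc ⌊Y⌋₊ ⌊Z⌋₊, φ n := by
      simp only [mul_ite, mul_one, mul_zero]
      rw [← Finset.sum_filter]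
      refine Finset.sum_congr ?_ fun _ _ => rfl
      ext n
      simp only [Finset.mem_filter, Finset.mem_Icc, Finset.mem_Ioc, Nat.floor_lt hY,
        Nat.le_floor_iff (hY.trans hYZ)]
      constructor
      · tauto
      · rintro ⟨h1, h2⟩
        refine ⟨⟨?_, ?_⟩, h1, h2⟩
        · exact_mod_cast hY.trans_lt h1
        · exact_mod_cast h2.trans hZN
    simp only [pow_zero, Module.End.one_apply, one_mul, mul_one, zero_add, pow_one, resSum, h1]
    exact abs_mul_sum_Ioc_periodic_sub_le hφ hφ0 hY hYZ
  | succ i ih =>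
    set lp := (1 + q / R) * (Real.log R + q / R) with hlp
    set lm := max (Real.log R - q / R) 0 with hlm
    have hlogR := Real.log_nonneg hR
    have hlp0 : 0 ≤ lp := by positivity
    have hlm0 : 0 ≤ lm := le_max_right _ _
    have hE : (0 : ℝ) ≤ q * (q * R ^ 2) ^ i := by positivity
    have hs : ∀ x ∈ Finset.Ioc ⌊R⌋₊ ⌊R ^ 2⌋₊, R < (x : ℝ) := fun x hx =>
      Nat.lt_of_floor_lt (Finset.mem_Ioc.1 hx).1
    have hψ := periodic_resSum hφ (i + 1)
    have hψ0 : ∀ n, 0 ≤ resSum q (i + 1) (fun m => φ (n * m)) :=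
      fun n => resSum_nonneg q _ fun m => hφ0 _
    have hihx := fun x (hx : x ∈ Finset.Ioc ⌊R⌋₊ ⌊R ^ 2⌋₊) =>
      ih (φ := fun n => φ (x * n)) (hφ.comp_nat_mul x) (fun n => hφ0 _)
        (Y := Y / x) (Z := Z / x) (by positivity)
        (by gcongr) (by
          have h1 := hs x hx
          exact (div_le_self (hY.trans hYZ) (by linarith)).trans hZN)
    rw [mulSum_interval_succ _ (fun x hx => by
      have := hs x hx
      exact_mod_cast hR0.trans this), pow_succ' (q : ℝ) (i + 1), mul_assoc, Finset.mul_sum]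
    have hres : ∑ r ∈ Finset.range q, resSum q (i + 1) (fun m => φ (r * m)) =
      resSum q (i + 1 + 1) φ := rfl
    have hS : 0 ≤ resSum q (i + 1 + 1) φ := resSum_nonneg q _ hφ0
    have hcount := sum_Ioc_periodic_le hq hψ hψ0 (show 0 ≤ R ^ 2 by positivity) ⌊R⌋₊
    rw [hres] at hcount
    have hcount' := mul_le_mul_of_nonneg_left hcount
      (show 0 ≤ q * (q * (q * R ^ 2) ^ i) by positivity)
    constructor
    · refine (mul_le_mul_of_nonneg_left (Finset.sum_le_sum fun x hx => (hihx x hx).1)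
        (Nat.cast_nonneg q)).trans ?_
      have h1 := sum_periodic_div_le hψ hψ0 hR
      rw [hres] at h1
      have h2 := mul_le_mul_of_nonneg_left h1
        (show 0 ≤ (Z - Y) * lp ^ i from mul_nonneg (by linarith) (by positivity))
      calc q * ∑ x ∈ Finset.Ioc ⌊R⌋₊ ⌊R ^ 2⌋₊, resSum q (i + 1) (fun m => φ (x * m)) *
              ((Z / x - Y / x) * lp ^ i + q * (q * R ^ 2) ^ i)
          = (Z - Y) * lp ^ i * (q * ∑ x ∈ Finset.Ioc ⌊R⌋₊ ⌊R ^ 2⌋₊,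
              resSum q (i + 1) (fun m => φ (x * m)) * (x : ℝ)⁻¹) +
            q * (q * (q * R ^ 2) ^ i) * ∑ x ∈ Finset.Ioc ⌊R⌋₊ ⌊R ^ 2⌋₊,
              resSum q (i + 1) (fun m => φ (x * m)) := by
            simp only [Finset.mul_sum, ← Finset.sum_add_distrib]
            exact Finset.sum_congr rfl fun x _ => by ring
        _ ≤ _ := add_le_add h2 hcount'
        _ = _ := by ring
    · refine le_trans ?_ (mul_le_mul_of_nonneg_left (Finset.sum_le_sum fun x hx => (hihx x hx).2)
        (Nat.cast_nonneg q))
      have h1 := le_sum_periodic_div hψ hψ0 hR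
      rw [hres] at h1
      have h2 := mul_le_mul_of_nonneg_left h1
        (show 0 ≤ (Z - Y) * lm ^ i from mul_nonneg (by linarith) (by positivity))
      calc _ = (Z - Y) * lm ^ i * (resSum q (i + 1 + 1) φ * lm) -
              q * (q * (q * R ^ 2) ^ i) * (resSum q (i + 1 + 1) φ * R ^ 2) := by ring
        _ ≤ _ := sub_le_sub h2 hcount'
        _ = _ := by
            simp only [Finset.mul_sum, ← Finset.sum_sub_distrib]
            exact Finset.sum_congr rfl fun x _ => by ring

lemma one_add_pow_le_one_add_mul {ε : ℝ} (h0 : 0 ≤ ε) (h1 : ε ≤ 1) (m : ℕ) :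
    (1 + ε) ^ m ≤ 1 + (2 ^ m - 1) * ε := by
  induction m with
  | zero => simp
  | succ m ih =>
    have h2 : (1 : ℝ) ≤ 2 ^ m := one_le_pow₀ (by norm_num)
    rw [pow_succ, pow_succ]
    nlinarith [mul_le_mul_of_nonneg_right ih (show 0 ≤ 1 + ε by linarith),
      mul_nonneg (mul_nonneg h0 (sub_nonneg.2 h1)) (sub_nonneg.2 h2)]

lemma pow_sub_pow_le_mul {a b : ℝ} (ha : 0 ≤ a) (hab : a ≤ b) (p : ℕ) :
    b ^ p - a ^ p ≤ (b - a) * p * b ^ (p - 1) := by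
  have h := (le_abs_self _).trans (abs_pow_sub_pow_le b a p)
  rwa [abs_of_nonneg (sub_nonneg.2 hab), abs_of_nonneg ha, abs_of_nonneg (ha.trans hab),
    max_eq_left hab] at h

lemma abs_mulSum_cumul_sub_le {R : ℝ} (hR : 1 ≤ R) {q N p : ℕ} (hqR : (q : ℝ) ≤ R)
    {φ : ℕ → ℝ} (hφ : Function.Periodic φ q) (hφ0 : ∀ n, 0 ≤ φ n) {Y Z Λ : ℝ}
    (hY : R ^ (p + 1) ≤ Y) (hYZ : Y ≤ Z) (hZN : Z + q ≤ N) (hΛ : Real.log (Z * 2 ^ (p + 1)) ≤ Λ) :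
    |(q : ℝ) ^ (p + 1) * (mulSum (Finset.Ioc ⌊R⌋₊ N) ^ (p + 1))
        (fun n => φ n * if Y < (n : ℝ) ∧ (n : ℝ) ≤ Z then 1 else 0) 1 -
      resSum q (p + 1) φ *
        ((Z - Y) * (Real.log (Y / R ^ (p + 1)) ^ p / (Nat.factorial p : ℝ)))| ≤
      resSum q (p + 1) φ * ((Z - Y) * ((Z - Y) / Y) * p * Λ ^ (p - 1) +
        2 ^ (p + 2) * Z * (q / R) * Λ ^ p) := by
  have hR0 : 0 < R := by linarith
  have hRp : 1 ≤ R ^ (p + 1) := one_le_pow₀ hR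
  have hY0 : 0 < Y := by linarith
  have hZ0 : 0 < Z := by linarith
  have hRR : R ≤ R ^ (p + 1) := le_self_pow₀ hR (by omega)
  have hq0 : (0 : ℝ) ≤ q := Nat.cast_nonneg q
  have hRN : R ≤ N := by linarith
  have hA := resSum_nonneg q (p + 1) hφ0
  set A := resSum q (p + 1) φ
  set V := boxVol R (p + 1) with hV
  have hε0 : 0 ≤ q / R := by positivity
  have hε1 : q / R ≤ 1 := by rwa [div_le_one hR0]
  set D := (1 + q / R) ^ (p + 1) with hD
  have hD1 : 1 ≤ D := one_le_pow₀ (by linarith)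
  have hD0 : 0 < D := by linarith
  have hD2 : D ≤ 2 ^ (p + 1) := pow_le_pow_left₀ (by linarith) (by linarith) _
  have hDε : D - 1 ≤ 2 ^ (p + 1) * (q / R) := by
    have := one_add_pow_le_one_add_mul hε0 hε1 (p + 1)
    linarith
  have hf : (1 : ℝ) ≤ Nat.factorial p := by exact_mod_cast Nat.factorial_pos p
  have hf0 : (0 : ℝ) < Nat.factorial p := by linarith
  have hlogs : ∀ T, R ^ (p + 1) ≤ T → T ≤ Z * 2 ^ (p + 1) →
      0 ≤ Real.log (T / R ^ (p + 1)) ∧ Real.log (T / R ^ (p + 1)) ≤ Λ := by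
    intro T h1 h2
    have hT0 : 0 < T := by linarith
    refine ⟨Real.log_nonneg (by rwa [one_le_div (by positivity)]), ?_⟩
    refine (Real.log_le_log (by positivity) ?_).trans hΛ
    exact (div_le_self hT0.le hRp).trans h2
  have hp1 : (1 : ℝ) ≤ 2 ^ (p + 1) := one_le_pow₀ (by norm_num)
  have hZP : Z ≤ Z * 2 ^ (p + 1) := le_mul_of_one_le_right hZ0.le hp1
  have hYP : Y ≤ Z * 2 ^ (p + 1) := hYZ.trans hZP
  have hZD : Z ≤ Z * D := le_mul_of_one_le_right hZ0.le hD1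
  have hYD : Y ≤ Y * D := le_mul_of_one_le_right hY0.le hD1
  have hYZR : R ^ (p + 1) ≤ Z := hY.trans hYZ
  have hΛ0 : 0 ≤ Λ := (hlogs Y hY hYP).1.trans (hlogs Y hY hYP).2
  have hpow : ∀ T, R ^ (p + 1) ≤ T → T ≤ Z * 2 ^ (p + 1) →
      Real.log (T / R ^ (p + 1)) ^ p / (Nat.factorial p : ℝ) ≤ Λ ^ p := by
    intro T h1 h2
    obtain ⟨h3, h4⟩ := hlogs T h1 h2
    exact (div_le_self (by positivity) hf).trans (pow_le_pow_left₀ h3 h4 p)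
  have herr : ∀ S T, S ≤ T → T - S ≤ Z * (D - 1) → R ^ (p + 1) ≤ T → T ≤ Z * 2 ^ (p + 1) →
      V T - V S ≤ Z * (D - 1) * Λ ^ p := by
    intro S T h1 h2 h3 h4
    refine (boxVol_succ_sub_le hR0 p h1 h3).trans ?_
    have h5 := (hlogs T h3 h4).1
    exact mul_le_mul h2 (hpow T h3 h4) (by positivity) (mul_nonneg hZ0.le (by linarith))
  have e1 := herr Z (Z * D) hZD (by linarith) (hYZR.trans hZD)
    (mul_le_mul_of_nonneg_left hD2 hZ0.le)
  have hdiv : ∀ T, 0 < T → T ≤ Z → T - T / D ≤ Z * (D - 1) := by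
    intro T h1 h2
    have h3 : T - T / D = T * (D - 1) / D := by field_simp
    rw [h3]
    refine (div_le_self (mul_nonneg h1.le (by linarith)) hD1).trans ?_
    exact mul_le_mul_of_nonneg_right h2 (by linarith)
  have e2 := herr (Y / D) Y (div_le_self hY0.le hD1) (hdiv Y hY0 hYZ) hY hYP
  have e3 := herr (Z / D) Z (div_le_self hZ0.le hD1) (hdiv Z hZ0 le_rfl) hYZR hZP
  have e4 := herr Y (Y * D) hYD
    (by
      have := mul_le_mul_of_nonneg_right hYZ (sub_nonneg.2 hD1)
      linarith)
    (hY.trans hYD) (mul_le_mul hYZ hD2 hD0.le hZ0.le)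
  have e5 := boxVol_succ_sub_le hR0 p hYZ hYZR
  have e6 := le_boxVol_succ_sub hR0 p hY hYZ
  have e7 : (Z - Y) * (Real.log (Z / R ^ (p + 1)) ^ p / (Nat.factorial p : ℝ)) ≤
      (Z - Y) * (Real.log (Y / R ^ (p + 1)) ^ p / (Nat.factorial p : ℝ)) +
        (Z - Y) * ((Z - Y) / Y) * p * Λ ^ (p - 1) := by
    obtain ⟨h1, -⟩ := hlogs Y hY hYP
    obtain ⟨h2, h3⟩ := hlogs Z hYZR hZP
    have h4 : Real.log (Z / R ^ (p + 1)) - Real.log (Y / R ^ (p + 1)) ≤ (Z - Y) / Y := by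
      rw [Real.log_div (by positivity) (by positivity),
        Real.log_div (by positivity) (by positivity), sub_sub_sub_cancel_right,
        ← Real.log_div (by positivity) (by positivity), sub_div, div_self hY0.ne']
      exact Real.log_le_sub_one_of_pos (by positivity)
    have h5 : Real.log (Y / R ^ (p + 1)) ≤ Real.log (Z / R ^ (p + 1)) :=
      Real.log_le_log (by positivity) (by gcongr)
    have h6 := pow_sub_pow_le_mul h1 h5 p
    have h7 : (Real.log (Z / R ^ (p + 1)) - Real.log (Y / R ^ (p + 1))) * p *
        Real.log (Z / R ^ (p + 1)) ^ (p - 1) ≤ (Z - Y) / Y * p * Λ ^ (p - 1) := by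
      have : 0 ≤ (Z - Y) / Y := div_nonneg (by linarith) hY0.le
      gcongr
    have h8 : (Real.log (Z / R ^ (p + 1)) ^ p - Real.log (Y / R ^ (p + 1)) ^ p) /
        (Nat.factorial p : ℝ) ≤ (Z - Y) / Y * p * Λ ^ (p - 1) := by
      refine (div_le_self ?_ hf).trans (h6.trans h7)
      exact sub_nonneg.2 (pow_le_pow_left₀ h1 h5 p)
    have h9 := mul_le_mul_of_nonneg_left h8 (sub_nonneg.2 hYZ)
    rw [sub_div, mul_sub] at h9
    linarith
  have hEE : Z * (D - 1) * Λ ^ p + Z * (D - 1) * Λ ^ p ≤ 2 ^ (p + 2) * Z * (q / R) * Λ ^ p := by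
    have : Z * (D - 1) * Λ ^ p ≤ Z * (2 ^ (p + 1) * (q / R)) * Λ ^ p := by gcongr
    rw [pow_succ _ (p + 1)]
    linarith
  have hsplit : (mulSum (Finset.Ioc ⌊R⌋₊ N) ^ (p + 1))
        (fun n => φ n * if Y < (n : ℝ) ∧ (n : ℝ) ≤ Z then 1 else 0) 1 =
      (mulSum (Finset.Ioc ⌊R⌋₊ N) ^ (p + 1)) (fun n => φ n * if (n : ℝ) ≤ Z then 1 else 0) 1 -
      (mulSum (Finset.Ioc ⌊R⌋₊ N) ^ (p + 1)) (fun n => φ n * if (n : ℝ) ≤ Y then 1 else 0) 1 := by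
    rw [← mulSum_pow_sub]
    refine mulSum_pow_congr _ _ fun n => ?_
    by_cases h1 : (n : ℝ) ≤ Y
    · have h2 : (n : ℝ) ≤ Z := h1.trans hYZ
      simp [h1, h2, not_lt.2 h1]
    · simp [h1, not_le.1 h1]
  have f1 := pow_mul_mulSum_cumul_le hR0 q N (p + 1) hRN hφ hφ0 Z
  have f2 := pow_mul_mulSum_cumul_le hR0 q N (p + 1) hRN hφ hφ0 Y
  have f3 := le_pow_mul_mulSum_cumul hR q N (p + 1) hRN hφ hφ0 hZ0.le hZN
  have f4 := le_pow_mul_mulSum_cumul hR q N (p + 1) hRN hφ hφ0 hY0.le (by linarith)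
  rw [hsplit, mul_sub, abs_le]
  constructor
  · have := mul_le_mul_of_nonneg_left (show
      (Z - Y) * (Real.log (Y / R ^ (p + 1)) ^ p / (Nat.factorial p : ℝ)) -
        2 ^ (p + 2) * Z * (q / R) * Λ ^ p ≤ V (Z / D) - V (Y * D) by linarith) hA
    have hnn : 0 ≤ A * ((Z - Y) * ((Z - Y) / Y) * p * Λ ^ (p - 1)) := by
      have : 0 ≤ Z - Y := by linarith
      positivity
    rw [mul_sub, mul_sub] at this
    rw [mul_add]
    linarith
  · have := mul_le_mul_of_nonneg_left (show V (Z * D) - V (Y / D) ≤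
      (Z - Y) * (Real.log (Y / R ^ (p + 1)) ^ p / (Nat.factorial p : ℝ)) +
      ((Z - Y) * ((Z - Y) / Y) * p * Λ ^ (p - 1) +
        2 ^ (p + 2) * Z * (q / R) * Λ ^ p) by linarith) hA
    rw [mul_add, mul_sub] at this
    linarith

lemma abs_mulSum_interval_sub_le {R : ℝ} (hR : 1 ≤ R) {q : ℕ} (hq : 0 < q) (hqR : (q : ℝ) ≤ R)
    (N p : ℕ) {φ : ℕ → ℝ} (hφ : Function.Periodic φ q) (hφ0 : ∀ n, 0 ≤ φ n) {Y Z : ℝ}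
    (hY : 0 ≤ Y) (hYZ : Y ≤ Z) (hZN : Z ≤ N) :
    |(q : ℝ) ^ (p + 1) * (mulSum (Finset.Ioc ⌊R⌋₊ ⌊R ^ 2⌋₊) ^ p)
        (fun c => ∑ y ∈ Finset.Icc 1 N, φ (c * y) *
          if Y < ((c * y : ℕ) : ℝ) ∧ ((c * y : ℕ) : ℝ) ≤ Z then 1 else 0) 1 -
      resSum q (p + 1) φ * ((Z - Y) * Real.log R ^ p)| ≤
      resSum q (p + 1) φ * ((Z - Y) * p * (q / R) * (2 * Real.log R + 2) ^ p +
        q * (q * R ^ 2) ^ p) := by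
  have hR0 : 0 < R := by linarith
  have hA := resSum_nonneg q (p + 1) hφ0
  have hlog := Real.log_nonneg hR
  set A := resSum q (p + 1) φ
  set lam := Real.log R with hlam
  obtain ⟨h1, h2⟩ := mulSum_interval_bounds hR hq N p hφ hφ0 hY hYZ hZN
  have hε0 : 0 ≤ q / R := by positivity
  have hε1 : q / R ≤ 1 := by rwa [div_le_one hR0]
  set ε := q / R with hε
  rcases Nat.eq_zero_or_pos p with rfl | hp
  · simp only [pow_zero, mul_one, Nat.cast_zero, mul_zero, zero_mul, zero_add] at h1 h2 ⊢
    rw [abs_le]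
    rw [mul_add] at h1
    rw [mul_sub] at h2
    constructor <;> linarith
  have hpp : ∀ x : ℝ, x ^ p = x * x ^ (p - 1) := fun x => by
    rw [← pow_succ', Nat.sub_add_cancel hp]
  have hZY : 0 ≤ Z - Y := by linarith
  have k1 : ((1 + ε) * (lam + ε)) ^ p ≤ lam ^ p + p * ε * (2 * lam + 2) ^ p := by
    have h3 := pow_sub_pow_le_mul hlog (show lam ≤ (1 + ε) * (lam + ε) by nlinarith) p
    have h4 : (1 + ε) * (lam + ε) - lam ≤ ε * (2 * lam + 2) := by nlinarith
    have h5 : (1 + ε) * (lam + ε) ≤ 2 * lam + 2 := by nlinarith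
    have h6 : ((1 + ε) * (lam + ε) - lam) * p * ((1 + ε) * (lam + ε)) ^ (p - 1) ≤
        ε * (2 * lam + 2) * p * (2 * lam + 2) ^ (p - 1) := by gcongr
    have h7 : ε * (2 * lam + 2) * p * (2 * lam + 2) ^ (p - 1) = p * ε * (2 * lam + 2) ^ p := by
      rw [hpp (2 * lam + 2)]; ring
    linarith
  have k2 : lam ^ p - p * ε * (2 * lam + 2) ^ p ≤ (max (lam - ε) 0) ^ p := by
    have h3 := pow_sub_pow_le_mul (le_max_right (lam - ε) 0)
      (show max (lam - ε) 0 ≤ lam from max_le (by linarith) hlog) p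
    have h4 : lam - max (lam - ε) 0 ≤ ε * (2 * lam + 2) := by
      have := le_max_left (lam - ε) 0
      nlinarith
    have h6 : (lam - max (lam - ε) 0) * p * lam ^ (p - 1) ≤
        ε * (2 * lam + 2) * p * (2 * lam + 2) ^ (p - 1) := by gcongr; linarith
    have h7 : ε * (2 * lam + 2) * p * (2 * lam + 2) ^ (p - 1) = p * ε * (2 * lam + 2) ^ p := by
      rw [hpp (2 * lam + 2)]; ring
    linarith
  have k1' := mul_le_mul_of_nonneg_left (mul_le_mul_of_nonneg_left k1 hZY) hA
  have k2' := mul_le_mul_of_nonneg_left (mul_le_mul_of_nonneg_left k2 hZY) hA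
  rw [mul_add A] at h1
  rw [mul_sub A] at h2
  rw [abs_le]
  constructor
  · linarith
  · linarith

lemma abs_log_pow_sub_log_pow_le {a Y n Z Λ : ℝ} (p : ℕ) (ha : 0 < a) (haY : a ≤ Y) (hYn : Y ≤ n)
    (hnZ : n ≤ Z) (hΛ : Real.log (Z / a) ≤ Λ) :
    |Real.log (n / a) ^ p - Real.log (Y / a) ^ p| ≤ p * ((Z - Y) / Y) * Λ ^ (p - 1) := by
  have hY0 : 0 < Y := by linarith
  have hn0 : 0 < n := by linarith
  have h1 : 0 ≤ Real.log (Y / a) := Real.log_nonneg (by rwa [one_le_div ha])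
  have h5 : Real.log (Y / a) ≤ Real.log (n / a) :=
    Real.log_le_log (by positivity) (by gcongr)
  have h3 : Real.log (n / a) ≤ Λ :=
    (Real.log_le_log (by positivity) (by gcongr)).trans hΛ
  have h4 : Real.log (n / a) - Real.log (Y / a) ≤ (Z - Y) / Y := by
    rw [Real.log_div (by positivity) (by positivity),
      Real.log_div (by positivity) (by positivity), sub_sub_sub_cancel_right,
      ← Real.log_div (by positivity) (by positivity), sub_div, div_self hY0.ne']
    refine (Real.log_le_sub_one_of_pos (by positivity)).trans ?_
    gcongr
  have h6 := pow_sub_pow_le_mul h1 h5 p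
  rw [abs_of_nonneg (sub_nonneg.2 (pow_le_pow_left₀ h1 h5 p))]
  refine h6.trans ?_
  rw [mul_comm (p : ℝ)]
  have : 0 ≤ (Z - Y) / Y := div_nonneg (by linarith) hY0.le
  have h0 := h1.trans h5
  gcongr

lemma abs_mulSum_cumul_sub_mulSum_interval_le {R : ℝ} (hR : 1 < R) {q N p : ℕ} (hq : 0 < q)
    (hqR : (q : ℝ) ≤ R) {φ : ℕ → ℝ} (hφ : Function.Periodic φ q) (hφ0 : ∀ n, 0 ≤ φ n)
    (hφ1 : ∀ n, φ n ≤ 1) {Y Z Λ M : ℝ} (hY : R ^ (p + 1) ≤ Y) (hYZ : Y ≤ Z) (hZY : Z ≤ 2 * Y)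
    (hZN : Z + q ≤ N) (hΛ : Real.log (Z * 2 ^ (p + 1)) ≤ Λ) (hΛR : 2 * Real.log R + 2 ≤ Λ)
    (hM : Λ ^ p ≤ M * Real.log R ^ p) :
    |(mulSum (Finset.Ioc ⌊R⌋₊ N) ^ (p + 1))
        (fun n => φ n * if Y < (n : ℝ) ∧ (n : ℝ) ≤ Z then 1 else 0) 1 -
      (mulSum (Finset.Ioc ⌊R⌋₊ ⌊R ^ 2⌋₊) ^ p)
        (fun c => ∑ y ∈ Finset.Icc 1 N, (φ (c * y) *
          if Y < ((c * y : ℕ) : ℝ) ∧ ((c * y : ℕ) : ℝ) ≤ Z then 1 else 0) *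
          (Real.log ((c * y : ℕ) / R ^ (p + 1)) ^ p /
            ((Nat.factorial p : ℝ) * Real.log R ^ p))) 1| ≤
      2 * p * ((Z - Y) ^ 2 / Y) * Λ ^ (p - 1) +
        (2 ^ (p + 2) + (p + 1) ^ 2 * M) * Z * (q / R) * Λ ^ p +
        (p + 1) * M * (q * (q * R ^ 2) ^ p) := by
  have hR0 : 0 < R := by linarith
  have hlam : 0 < Real.log R := Real.log_pos hR
  have hRp : 1 ≤ R ^ (p + 1) := one_le_pow₀ hR.le
  have hY0 : 0 < Y := by linarith
  have hZ0 : 0 < Z := by linarith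
  have hq0 : (0 : ℝ) < q := by exact_mod_cast hq
  have hf : (1 : ℝ) ≤ Nat.factorial p := by exact_mod_cast Nat.factorial_pos p
  have hA := resSum_nonneg q (p + 1) hφ0
  have hA1 := resSum_le q (p + 1) hφ1
  have hZN' : Z ≤ N := by linarith
  have e1 := abs_mulSum_cumul_sub_le hR.le hqR hφ hφ0 hY hYZ hZN hΛ
  have e2 := abs_mulSum_interval_sub_le hR.le hq hqR N p hφ hφ0 hY0.le hYZ hZN'
  have hlogZ : Real.log (Z / R ^ (p + 1)) ≤ Λ := by
    refine (Real.log_le_log (by positivity) ?_).trans hΛ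
    exact (div_le_self hZ0.le hRp).trans (le_mul_of_one_le_right hZ0.le (one_le_pow₀ (by norm_num)))
  set A := resSum q (p + 1) φ
  set lam := Real.log R
  set F := (mulSum (Finset.Ioc ⌊R⌋₊ N) ^ (p + 1))
        (fun n => φ n * if Y < (n : ℝ) ∧ (n : ℝ) ≤ Z then 1 else 0) 1
  set K := (mulSum (Finset.Ioc ⌊R⌋₊ ⌊R ^ 2⌋₊) ^ p)
        (fun c => ∑ y ∈ Finset.Icc 1 N, φ (c * y) *
          if Y < ((c * y : ℕ) : ℝ) ∧ ((c * y : ℕ) : ℝ) ≤ Z then 1 else 0) 1 with hK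
  set w : ℝ → ℝ := fun n => Real.log (n / R ^ (p + 1)) ^ p / ((Nat.factorial p : ℝ) * lam ^ p)
    with hw
  have hΛ0 : 0 < Λ := by linarith
  set δ := p * ((Z - Y) / Y) * Λ ^ (p - 1) / lam ^ p with hδ
  have hlp : 0 < lam ^ p := by positivity
  have hfl : 0 < (Nat.factorial p : ℝ) * lam ^ p := by positivity
  have hη0 : 0 ≤ (Z - Y) / Y := div_nonneg (by linarith) hY0.le
  have hη1 : (Z - Y) / Y ≤ 1 := by rw [div_le_one hY0]; linarith
  have hδ0 : 0 ≤ δ := by positivity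
  have hwd : ∀ n : ℝ, Y < n → n ≤ Z → |w n - w Y| ≤ δ := by
    intro n h1 h2
    rw [hw]
    simp only
    rw [← sub_div, abs_div, abs_of_pos hfl, hδ]
    have := abs_log_pow_sub_log_pow_le p (by linarith) hY h1.le h2 hlogZ
    refine div_le_div₀ (by positivity) this hlp ?_
    exact le_mul_of_one_le_left hlp.le hf
  have hG : |(mulSum (Finset.Ioc ⌊R⌋₊ ⌊R ^ 2⌋₊) ^ p)
        (fun c => ∑ y ∈ Finset.Icc 1 N, (φ (c * y) *
          if Y < ((c * y : ℕ) : ℝ) ∧ ((c * y : ℕ) : ℝ) ≤ Z then 1 else 0) *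
          (Real.log ((c * y : ℕ) / R ^ (p + 1)) ^ p /
            ((Nat.factorial p : ℝ) * lam ^ p))) 1 - w Y * K| ≤ δ * K := by
    rw [hK, ← mulSum_pow_const_mul, ← mulSum_pow_const_mul, ← mulSum_pow_sub]
    refine abs_mulSum_pow_le_of_le (R := R ^ 2) ?_ p ?_
    · intro x hx
      rw [Finset.mem_Ioc] at hx
      exact ⟨by omega, (Nat.le_floor_iff (by positivity)).1 hx.2⟩
    · intro c _ _
      rw [Finset.mul_sum, Finset.mul_sum, ← Finset.sum_sub_distrib]
      refine (Finset.abs_sum_le_sum_abs _ _).trans (Finset.sum_le_sum fun y _ => ?_)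
      rw [mul_comm (w Y), ← mul_sub, abs_mul, mul_comm δ]
      split_ifs with h
      · rw [mul_one, abs_of_nonneg (hφ0 _)]
        exact mul_le_mul_of_nonneg_left (hwd _ h.1 h.2) (hφ0 _)
      · simp
  set G := (mulSum (Finset.Ioc ⌊R⌋₊ ⌊R ^ 2⌋₊) ^ p)
        (fun c => ∑ y ∈ Finset.Icc 1 N, (φ (c * y) *
          if Y < ((c * y : ℕ) : ℝ) ∧ ((c * y : ℕ) : ℝ) ≤ Z then 1 else 0) *
          (Real.log ((c * y : ℕ) / R ^ (p + 1)) ^ p /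
            ((Nat.factorial p : ℝ) * lam ^ p))) 1
  have hQ : (0 : ℝ) < q ^ (p + 1) := by positivity
  have hscale : ∀ F c S : ℝ, 0 ≤ S → |(q : ℝ) ^ (p + 1) * F - A * c| ≤ A * S →
      |F - A / q ^ (p + 1) * c| ≤ S := by
    intro F c S hS h
    have h1 : F - A / q ^ (p + 1) * c = ((q : ℝ) ^ (p + 1) * F - A * c) / q ^ (p + 1) := by
      field_simp
    rw [h1, abs_div, abs_of_pos hQ, div_le_iff₀ hQ]
    refine h.trans ?_
    rw [mul_comm]
    exact mul_le_mul_of_nonneg_left hA1 hS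
  have hB0 : 0 ≤ A / q ^ (p + 1) := by positivity
  have hB1 : A / q ^ (p + 1) ≤ 1 := by rwa [div_le_one hQ]
  have hZY0 : 0 ≤ Z - Y := by linarith
  set s2 := (Z - Y) * p * (q / R) * (2 * lam + 2) ^ p + q * (q * R ^ 2) ^ p with hs2
  have hs20 : 0 ≤ s2 := by positivity
  have f1 := hscale _ _ _ (by positivity) e1
  have f2 := hscale _ _ _ hs20 e2
  set B := A / q ^ (p + 1)
  have hw0 : 0 ≤ w Y := by
    have : 0 ≤ Real.log (Y / R ^ (p + 1)) :=
      Real.log_nonneg (by rwa [one_le_div (by positivity)])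
    simp only [hw]
    positivity
  have hwM : w Y ≤ M := by
    have h1 : 0 ≤ Real.log (Y / R ^ (p + 1)) :=
      Real.log_nonneg (by rwa [one_le_div (by positivity)])
    have h2 : Real.log (Y / R ^ (p + 1)) ≤ Λ :=
      (Real.log_le_log (by positivity) (by gcongr)).trans hlogZ
    simp only [hw]
    rw [div_le_iff₀ hfl]
    have h3 := pow_le_pow_left₀ h1 h2 p
    have hM0 : 0 ≤ M := by
      have : 0 < M * lam ^ p := (pow_pos hΛ0 p).trans_le hM
      exact (pos_of_mul_pos_left this hlp.le).le
    calc _ ≤ M * lam ^ p := h3.trans hM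
      _ ≤ M * (Nat.factorial p * lam ^ p) := by
        gcongr
        exact le_mul_of_one_le_left hlp.le hf
  have hM0 : 0 ≤ M := hw0.trans hwM
  have hwl : w Y * lam ^ p = Real.log (Y / R ^ (p + 1)) ^ p / (Nat.factorial p : ℝ) := by
    simp only [hw]
    field_simp
  have hδM : δ ≤ p * M := by
    rw [hδ, div_le_iff₀ hlp]
    rcases Nat.eq_zero_or_pos p with rfl | hp
    · simp
    have h1 : Λ ^ (p - 1) ≤ Λ ^ p := pow_le_pow_right₀ (by linarith) (by omega)
    calc p * ((Z - Y) / Y) * Λ ^ (p - 1) ≤ p * 1 * Λ ^ p := by gcongr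
      _ ≤ p * M * lam ^ p := by
        rw [mul_one, mul_assoc]
        gcongr
  have hδl : δ * ((Z - Y) * lam ^ p) = (Z - Y) * ((Z - Y) / Y) * p * Λ ^ (p - 1) := by
    rw [hδ]; field_simp
  have hK1 : K ≤ (Z - Y) * lam ^ p + s2 := by
    have h1 := (abs_le.1 f2).2
    have h2 : B * ((Z - Y) * lam ^ p) ≤ (Z - Y) * lam ^ p :=
      mul_le_of_le_one_left (by positivity) hB1
    linarith
  have hs2' : s2 ≤ (p + 1) * Z * (q / R) * Λ ^ p + q * (q * R ^ 2) ^ p := by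
    have h1 : (Z - Y) * p * (q / R) * (2 * lam + 2) ^ p ≤ Z * (p + 1) * (q / R) * Λ ^ p := by
      gcongr <;> linarith
    rw [hs2]
    linarith
  have hwK : |w Y * K - B * ((Z - Y) * (w Y * lam ^ p))| ≤ M * s2 := by
    have h1 : w Y * K - B * ((Z - Y) * (w Y * lam ^ p)) =
      w Y * (K - B * ((Z - Y) * lam ^ p)) := by ring
    rw [h1, abs_mul, abs_of_nonneg hw0]
    exact mul_le_mul hwM f2 (abs_nonneg _) hM0
  rw [hwl] at hwK
  have hδK : δ * K ≤ (Z - Y) * ((Z - Y) / Y) * p * Λ ^ (p - 1) + p * M * s2 := by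
    refine (mul_le_mul_of_nonneg_left hK1 hδ0).trans ?_
    rw [mul_add, hδl]
    have := mul_le_mul_of_nonneg_right hδM hs20
    linarith
  have hfin : |F - G| ≤ ((Z - Y) * ((Z - Y) / Y) * p * Λ ^ (p - 1) +
        2 ^ (p + 2) * Z * (q / R) * Λ ^ p) + M * s2 +
        ((Z - Y) * ((Z - Y) / Y) * p * Λ ^ (p - 1) + p * M * s2) := by
    rw [abs_le] at f1 hwK hG ⊢
    constructor <;> linarith [f1.1, f1.2, hwK.1, hwK.2, hG.1, hG.2]
  have h8 := mul_le_mul_of_nonneg_left hs2' (show 0 ≤ (p + 1) * M by positivity)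
  have h9 : (Z - Y) ^ 2 / Y = (Z - Y) * ((Z - Y) / Y) := by ring
  rw [h9]
  refine hfin.trans ?_
  have h10 : (p + 1) * M * ((p + 1) * Z * (q / R) * Λ ^ p + q * (q * R ^ 2) ^ p) =
    (p + 1) ^ 2 * M * Z * (q / R) * Λ ^ p + (p + 1) * M * (q * (q * R ^ 2) ^ p) := by ring
  linarith

lemma abs_mulSum_pow_cumul_sub_interval_le {k j p : ℕ} (hk : j + p + 1 = k) (hk2 : 2 ≤ k)
    {S X H : ℝ} (hS : 1 < S) (hX : 2 ≤ X) (hXS : X = S ^ (100 * k)) (hH0 : 0 ≤ H) (hHX : H ≤ X) {q N : ℕ}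
    (hq : 0 < q) (hqS : (q : ℝ) ≤ S ^ 3) (hN : X + H + q ≤ N) {φ : ℕ → ℝ}
    (hφ : Function.Periodic φ q) (hφ0 : ∀ n, 0 ≤ φ n) (hφ1 : ∀ n, φ n ≤ 1) {M : ℝ}
    (hM : ((k + 2) * Real.log X) ^ p ≤ M * Real.log (S ^ 10) ^ p) {b : ℕ} (hb : 1 ≤ b)
    (hbR : (b : ℝ) ≤ (S ^ 10) ^ j) :
    |(mulSum (Finset.Ioc ⌊S ^ 10⌋₊ N) ^ (p + 1))
        (fun n => φ (n * b) *
          if X < ((n * b : ℕ) : ℝ) ∧ ((n * b : ℕ) : ℝ) ≤ X + H then 1 else 0) 1 -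
      (mulSum (Finset.Ioc ⌊S ^ 10⌋₊ ⌊(S ^ 10) ^ 2⌋₊) ^ p)
        (fun c => ∑ y ∈ Finset.Icc 1 N, (φ (b * c * y) *
          if X < ((b * c * y : ℕ) : ℝ) ∧ ((b * c * y : ℕ) : ℝ) ≤ X + H then 1 else 0) *
          ((Real.log ((b * c * y : ℕ) : ℝ) - Real.log (b * (S ^ 10) ^ (p + 1))) ^ p /
            ((Nat.factorial p : ℝ) * Real.log (S ^ 10) ^ p))) 1| ≤
      (2 * p * (H ^ 2 / X) * ((k + 2) * Real.log X) ^ (p - 1) +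
        (2 * (2 ^ (p + 2) + (p + 1) ^ 2 * M) + (p + 1) * M) * (X / S ^ 7) *
          ((k + 2) * Real.log X) ^ p) * (b : ℝ)⁻¹ := by
  have hS0 : 0 < S := by linarith
  have hR : 1 < S ^ 10 := one_lt_pow₀ hS (by norm_num)
  have hX0 : 0 < X := by linarith
  have hb1 : (1 : ℝ) ≤ b := by exact_mod_cast hb
  have hb0 : (0 : ℝ) < b := by linarith
  have hk0 : (2 : ℝ) ≤ k := by exact_mod_cast hk2
  have hL : 0.69 ≤ Real.log X := by
    have := Real.log_le_log (by norm_num) hX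
    have := Real.log_two_gt_d9
    linarith
  have hLS : Real.log X = 10 * k * Real.log (S ^ 10) := by
    rw [hXS, Real.log_pow, Real.log_pow]
    push_cast
    ring
  have hlam : 0 < Real.log (S ^ 10) := Real.log_pos hR
  have hφb : Function.Periodic (fun n => φ (n * b)) q := by
    have := hφ.comp_nat_mul b
    simpa only [mul_comm b] using this
  have hqR : (q : ℝ) ≤ S ^ 10 := hqS.trans (pow_le_pow_right₀ hS.le (by norm_num))
  have hY : (S ^ 10) ^ (p + 1) ≤ X / b := by
    rw [le_div_iff₀ hb0]
    calc (S ^ 10) ^ (p + 1) * b ≤ (S ^ 10) ^ (p + 1) * (S ^ 10) ^ j := by gcongr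
      _ ≤ X := by
        rw [← pow_add, ← pow_mul, hXS]
        exact pow_le_pow_right₀ hS.le (by omega)
  have hYZ : X / b ≤ (X + H) / b := by gcongr; linarith
  have hZY : (X + H) / b ≤ 2 * (X / b) := by
    rw [← mul_div_assoc]; gcongr; linarith
  have hZ1 : (X + H) / b ≤ X + H := div_le_self (by linarith) hb1
  have hΛ : Real.log ((X + H) / b * 2 ^ (p + 1)) ≤ (k + 2) * Real.log X := by
    have h1 : (X + H) / b * 2 ^ (p + 1) ≤ X ^ (k + 2) := by
      have hXp : (2 : ℝ) ^ (p + 1) ≤ X ^ k :=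
        (pow_le_pow_left₀ (by norm_num) hX _).trans
          (pow_le_pow_right₀ (by linarith) (by omega))
      calc (X + H) / b * 2 ^ (p + 1) ≤ (X * X) * X ^ k := by
            gcongr
            nlinarith
        _ = X ^ (k + 2) := by ring
    have h2 := Real.log_le_log (by positivity) h1
    rw [Real.log_pow] at h2
    push_cast at h2
    exact h2
  have hΛR : 2 * Real.log (S ^ 10) + 2 ≤ (k + 2) * Real.log X := by
    have h1 : (10 : ℝ) * k * Real.log (S ^ 10) ≥ 10 * 2 * Real.log (S ^ 10) := by gcongr
    nlinarith
  have key := abs_mulSum_cumul_sub_mulSum_interval_le hR hq hqR hφb (fun n => hφ0 _)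
    (fun n => hφ1 _) hY hYZ hZY (show (X + H) / b + q ≤ N by linarith) hΛ hΛR hM
  have hind : ∀ n : ℕ, (X / b < (n : ℝ) ∧ (n : ℝ) ≤ (X + H) / b) ↔
      (X < ((n * b : ℕ) : ℝ) ∧ ((n * b : ℕ) : ℝ) ≤ X + H) := by
    intro n
    rw [div_lt_iff₀ hb0, le_div_iff₀ hb0]
    push_cast
    rfl
  have hint : (mulSum (Finset.Ioc ⌊S ^ 10⌋₊ ⌊(S ^ 10) ^ 2⌋₊) ^ p)
        (fun c => ∑ y ∈ Finset.Icc 1 N, (φ (b * c * y) *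
          if X < ((b * c * y : ℕ) : ℝ) ∧ ((b * c * y : ℕ) : ℝ) ≤ X + H then 1 else 0) *
          ((Real.log ((b * c * y : ℕ) : ℝ) - Real.log (b * (S ^ 10) ^ (p + 1))) ^ p /
            ((Nat.factorial p : ℝ) * Real.log (S ^ 10) ^ p))) 1 =
      (mulSum (Finset.Ioc ⌊S ^ 10⌋₊ ⌊(S ^ 10) ^ 2⌋₊) ^ p)
        (fun c => ∑ y ∈ Finset.Icc 1 N, (φ (c * y * b) *
          if X / b < ((c * y : ℕ) : ℝ) ∧ ((c * y : ℕ) : ℝ) ≤ (X + H) / b then 1 else 0) *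
          (Real.log ((c * y : ℕ) / (S ^ 10) ^ (p + 1)) ^ p /
            ((Nat.factorial p : ℝ) * Real.log (S ^ 10) ^ p))) 1 := by
    refine mulSum_pow_congr _ _ fun c => Finset.sum_congr rfl fun y hy => ?_
    simp only [hind]
    rw [show b * c * y = c * y * b by ring]
    rcases Nat.eq_zero_or_pos (c * y) with h0 | h0
    · rw [h0]
      simp [not_lt.2 hX0.le]
    · have hcy : (0 : ℝ) < ((c * y : ℕ) : ℝ) := by exact_mod_cast h0
      congr 3
      rw [Nat.cast_mul (c * y) b, Real.log_mul hcy.ne' hb0.ne',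
        Real.log_mul hb0.ne' (by positivity), Real.log_div hcy.ne' (by positivity)]
      ring
  rw [hint]
  simp only [hind] at key ⊢
  refine key.trans ?_
  have hΛ0 : 0 < (k + 2) * Real.log X := by positivity
  set Λ := (k + 2) * Real.log X
  have hM0 : 0 ≤ M := by
    have : 0 < M * Real.log (S ^ 10) ^ p := (pow_pos hΛ0 p).trans_le hM
    exact (pos_of_mul_pos_left this (pow_pos hlam p).le).le
  have hΛ1 : 1 ≤ Λ ^ p := one_le_pow₀ (by linarith)
  have t1 : ((X + H) / b - X / b) ^ 2 / (X / b) = H ^ 2 / X * (b : ℝ)⁻¹ := by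
    field_simp
    ring
  have t2 : (X + H) / b * (q / S ^ 10) ≤ 2 * (X / S ^ 7) * (b : ℝ)⁻¹ := by
    calc (X + H) / b * (q / S ^ 10) ≤ (2 * X) / b * (S ^ 3 / S ^ 10) := by
          gcongr
          linarith
      _ = 2 * (X / S ^ 7) * (b : ℝ)⁻¹ := by field_simp
  have t3 : (q : ℝ) * (q * (S ^ 10) ^ 2) ^ p ≤ X / S ^ 7 * (b : ℝ)⁻¹ := by
    rw [← div_eq_mul_inv, le_div_iff₀ hb0, le_div_iff₀ (by positivity)]
    calc (q : ℝ) * (q * (S ^ 10) ^ 2) ^ p * b * S ^ 7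
        ≤ S ^ 3 * (S ^ 3 * (S ^ 10) ^ 2) ^ p * (S ^ 10) ^ j * S ^ 7 := by gcongr
      _ = S ^ (3 + 23 * p + 10 * j + 7) := by ring
      _ ≤ X := by
        rw [hXS]
        exact pow_le_pow_right₀ hS.le (by omega)
  rw [t1]
  have u2 : (2 ^ (p + 2) + (p + 1) ^ 2 * M) * ((X + H) / b) * (q / S ^ 10) * Λ ^ p ≤
      (2 ^ (p + 2) + (p + 1) ^ 2 * M) * (2 * (X / S ^ 7) * (b : ℝ)⁻¹) * Λ ^ p := by
    rw [mul_assoc (2 ^ (p + 2) + (p + 1) ^ 2 * M)]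
    gcongr
  have u3 : (p + 1) * M * (q * (q * (S ^ 10) ^ 2) ^ p) ≤
      (p + 1) * M * ((X / S ^ 7 * (b : ℝ)⁻¹) * Λ ^ p) := by
    exact mul_le_mul_of_nonneg_left (t3.trans (le_mul_of_one_le_right (by positivity) hΛ1))
      (by positivity)
  refine (add_le_add (add_le_add le_rfl u2) u3).trans_eq ?_
  ring

lemma abs_mulSum_mixed_sub_le {k j p : ℕ} (hk : j + p + 1 = k) (hk2 : 2 ≤ k) {S X H : ℝ}
    (hS : 1 < S) (hX : 2 ≤ X) (hXS : X = S ^ (100 * k)) (hH : X ≤ H * S ^ 2) (hHX : H ≤ X)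
    {q N : ℕ} (hq : 0 < q) (hqS : (q : ℝ) ≤ S ^ 3) (hN : X + H + q ≤ N) {φ : ℕ → ℝ}
    (hφ : Function.Periodic φ q) (hφ0 : ∀ n, 0 ≤ φ n) (hφ1 : ∀ n, φ n ≤ 1) {M : ℝ}
    (hM : ((k + 2) * Real.log X) ^ p ≤ M * Real.log (S ^ 10) ^ p) :
    |(mulSum (Finset.Icc 1 ⌊S ^ 10⌋₊) ^ j) (fun b =>
        (mulSum (Finset.Ioc ⌊S ^ 10⌋₊ N) ^ (p + 1))
        (fun n => φ (n * b) *
          if X < ((n * b : ℕ) : ℝ) ∧ ((n * b : ℕ) : ℝ) ≤ X + H then 1 else 0) 1) 1 -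
      (mulSum (Finset.Icc 1 ⌊S ^ 10⌋₊) ^ j) (fun b =>
        (mulSum (Finset.Ioc ⌊S ^ 10⌋₊ ⌊(S ^ 10) ^ 2⌋₊) ^ p)
        (fun c => ∑ y ∈ Finset.Icc 1 N, (φ (b * c * y) *
          if X < ((b * c * y : ℕ) : ℝ) ∧ ((b * c * y : ℕ) : ℝ) ≤ X + H then 1 else 0) *
          ((Real.log ((b * c * y : ℕ) : ℝ) - Real.log (b * (S ^ 10) ^ (p + 1))) ^ p /
            ((Nat.factorial p : ℝ) * Real.log (S ^ 10) ^ p))) 1) 1| ≤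
      (2 * p + (2 * (2 ^ (p + 2) + (p + 1) ^ 2 * M) + (p + 1) * M) * (100 * k * (k + 2))) *
        (H ^ 2 / X) * ((k + 2) * Real.log X) ^ (k - 2) := by
  have hS0 : 0 < S := by linarith
  have hR : 1 < S ^ 10 := one_lt_pow₀ hS (by norm_num)
  have hX0 : 0 < X := by linarith
  have hH0 : 0 ≤ H := by
    have : 0 < H * S ^ 2 := by linarith
    exact (pos_of_mul_pos_left this (by positivity)).le
  have hlam : 0 < Real.log (S ^ 10) := Real.log_pos hR
  have hk0 : (2 : ℝ) ≤ k := by exact_mod_cast hk2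
  have hL : 0.69 ≤ Real.log X := by
    have := Real.log_le_log (by norm_num) hX
    have := Real.log_two_gt_d9
    linarith
  have hLS : Real.log X = 100 * k * Real.log S := by
    rw [hXS, Real.log_pow]
    push_cast
    ring
  rw [← mulSum_pow_sub]
  have hs : ∀ x ∈ Finset.Icc 1 ⌊S ^ 10⌋₊, 1 ≤ x ∧ (x : ℝ) ≤ S ^ 10 := by
    intro x hx
    rw [Finset.mem_Icc] at hx
    exact ⟨hx.1, (Nat.le_floor_iff (by positivity)).1 hx.2⟩
  refine (abs_mulSum_pow_le hs j fun b hb hbR => abs_mulSum_pow_cumul_sub_interval_le hk hk2 hS hX hXS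
    hH0 hHX hq hqS hN hφ hφ0 hφ1 hM hb hbR).trans ?_
  have hΛ0 : 0 < (k + 2) * Real.log X := by positivity
  have hM0 : 0 ≤ M := by
    have : 0 < M * Real.log (S ^ 10) ^ p := (pow_pos hΛ0 p).trans_le hM
    exact (pos_of_mul_pos_left this (pow_pos hlam p).le).le
  have hharm : ∑ x ∈ Finset.Icc 1 ⌊S ^ 10⌋₊, (x : ℝ)⁻¹ ≤ (k + 2) * Real.log X := by
    have h1 := harmonic_floor_le_one_add_log (S ^ 10) hR.le
    rw [harmonic_eq_sum_Icc] at h1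
    push_cast at h1
    refine h1.trans ?_
    rw [Real.log_pow]
    push_cast
    have : (100 : ℝ) * k * Real.log S ≥ 100 * 2 * Real.log S := by
      have := Real.log_pos hS
      gcongr
    nlinarith
  have hXE : X / S ^ 7 * ((k + 2) * Real.log X) ≤ 100 * k * (k + 2) * (H ^ 2 / X) := by
    have h1 : Real.log S ≤ S ^ 3 :=
      (Real.log_le_self hS0.le).trans (le_self_pow₀ hS.le (by norm_num))
    have h2 : X / S ^ 7 * S ^ 3 ≤ H ^ 2 / X := by
      rw [le_div_iff₀ hX0]
      have h3 : X ^ 2 ≤ (H * S ^ 2) ^ 2 := by gcongr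
      calc X / S ^ 7 * S ^ 3 * X = X ^ 2 / S ^ 4 := by field_simp
        _ ≤ (H * S ^ 2) ^ 2 / S ^ 4 := by gcongr
        _ = H ^ 2 := by field_simp
    calc X / S ^ 7 * ((k + 2) * Real.log X) = 100 * k * (k + 2) * (X / S ^ 7 * Real.log S) := by
          rw [hLS]; ring
      _ ≤ 100 * k * (k + 2) * (X / S ^ 7 * S ^ 3) := by gcongr
      _ ≤ _ := by gcongr
  set Λ := (k + 2) * Real.log X
  set D := 2 * (2 ^ (p + 2) + (p + 1) ^ 2 * M) + (p + 1) * M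
  have hD0 : 0 ≤ D := by positivity
  have hsum0 : 0 ≤ ∑ x ∈ Finset.Icc 1 ⌊S ^ 10⌋₊, (x : ℝ)⁻¹ :=
    Finset.sum_nonneg fun x _ => by positivity
  have v1 : 2 * p * (H ^ 2 / X) * Λ ^ (p - 1) * Λ ^ j = 2 * p * (H ^ 2 / X) * Λ ^ (k - 2) := by
    rcases Nat.eq_zero_or_pos p with rfl | hp
    · simp
    · rw [mul_assoc, ← pow_add, show p - 1 + j = k - 2 by omega]
  have v2 : D * (X / S ^ 7) * Λ ^ p * Λ ^ j = D * (X / S ^ 7 * Λ) * Λ ^ (k - 2) := by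
    have : Λ ^ p * Λ ^ j = Λ * Λ ^ (k - 2) := by
      rw [← pow_add, ← pow_succ']
      congr 1
      omega
    rw [mul_assoc _ (Λ ^ p), this]
    ring
  calc _ ≤ (2 * p * (H ^ 2 / X) * Λ ^ (p - 1) + D * (X / S ^ 7) * Λ ^ p) * Λ ^ j := by gcongr
    _ = 2 * p * (H ^ 2 / X) * Λ ^ (k - 2) + D * (X / S ^ 7 * Λ) * Λ ^ (k - 2) := by
      rw [add_mul, v1, v2]
    _ ≤ 2 * p * (H ^ 2 / X) * Λ ^ (k - 2) +
        D * (100 * k * (k + 2) * (H ^ 2 / X)) * Λ ^ (k - 2) := by gcongr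
    _ = _ := by ring

lemma sum_mul_dk (k N : ℕ) (Φ : ℕ → ℝ) (hΦ : ∀ n, N < n → Φ n = 0) :
    ∑ n ∈ Finset.Icc 1 N, Φ n * (dk k n : ℝ) = (mulSum (Finset.Icc 1 N) ^ k) Φ 1 := by
  rw [← sum_piFinset_const]
  have h1 : ∀ n ∈ Finset.Icc 1 N, Φ n * (dk k n : ℝ) =
      ∑ v ∈ Fintype.piFinset (fun _ : Fin k => Finset.Icc 1 N),
        if n = ∏ i, v i then Φ n else 0 := by
    intro n hn
    rw [Finset.mem_Icc] at hn
    have h2 : (Fintype.piFinset fun _ : Fin k => Finset.range (n + 1)).filter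
        (fun v => ∏ i, v i = n) = (Fintype.piFinset fun _ : Fin k => Finset.Icc 1 N).filter
        (fun v => n = ∏ i, v i) := by
      ext v
      simp only [Finset.mem_filter, Fintype.mem_piFinset, Finset.mem_range, Finset.mem_Icc,
        eq_comm (a := n)]
      refine and_congr_left fun hv => forall_congr' fun i => ?_
      have hd : v i ∣ n := hv ▸ Finset.dvd_prod_of_mem v (Finset.mem_univ i)
      have h3 := Nat.le_of_dvd (by omega) hd
      have h4 := Nat.pos_of_dvd_of_pos hd (by omega)
      omega
    rw [dk, h2, ← Finset.sum_filter, Finset.sum_const, nsmul_eq_mul, mul_comm]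
  rw [Finset.sum_congr rfl h1, Finset.sum_comm]
  refine Finset.sum_congr rfl fun v hv => ?_
  rw [Finset.sum_ite_eq' (Finset.Icc 1 N)]
  split_ifs with h
  · rfl
  · have hpos : 0 < ∏ i, v i := Finset.prod_pos fun i _ =>
      (Finset.mem_Icc.1 (Fintype.mem_piFinset.1 hv i)).1
    rw [Finset.mem_Icc] at h
    exact (hΦ _ (by omega)).symm

lemma mulSum_Icc_pow_eq_sum {R : ℝ} (hR : 0 ≤ R) {N : ℕ} (hRN : R ≤ N) (k : ℕ) {Φ : ℕ → ℝ}
    (hΦ : ∀ b : ℕ, (b : ℝ) ≤ R ^ k → Φ b = 0) :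
    (mulSum (Finset.Icc 1 N) ^ k) Φ 1 = ∑ j ∈ Finset.range k, (k.choose j : ℝ) *
      (mulSum (Finset.Icc 1 ⌊R⌋₊) ^ j)
        (fun b => (mulSum (Finset.Ioc ⌊R⌋₊ N) ^ (k - j)) (fun n => Φ (n * b)) 1) 1 := by
  have hfl : ⌊R⌋₊ ≤ N := Nat.floor_le_of_le hRN
  have hunion : Finset.Icc 1 N = Finset.Icc 1 ⌊R⌋₊ ∪ Finset.Ioc ⌊R⌋₊ N := by
    ext x
    simp only [Finset.mem_union, Finset.mem_Icc, Finset.mem_Ioc]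
    omega
  have hdisj : Disjoint (Finset.Icc 1 ⌊R⌋₊) (Finset.Ioc ⌊R⌋₊ N) := by
    rw [Finset.disjoint_left]
    intro x hx hx'
    rw [Finset.mem_Icc] at hx
    rw [Finset.mem_Ioc] at hx'
    omega
  have hterm : ∀ j, (mulSum (Finset.Icc 1 ⌊R⌋₊) ^ j *
      mulSum (Finset.Ioc ⌊R⌋₊ N) ^ (k - j) * (k.choose j : Module.End ℝ (ℕ → ℝ))) Φ 1 =
      (k.choose j : ℝ) * (mulSum (Finset.Icc 1 ⌊R⌋₊) ^ j)
        (fun b => (mulSum (Finset.Ioc ⌊R⌋₊ N) ^ (k - j)) (fun n => Φ (n * b)) 1) 1 := by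
    intro j
    have h1 : (k.choose j : Module.End ℝ (ℕ → ℝ)) Φ = (k.choose j : ℝ) • Φ := by
      rw [Module.End.natCast_apply, Nat.cast_smul_eq_nsmul]
    rw [Module.End.mul_apply, Module.End.mul_apply, h1, map_smul, map_smul]
    simp only [Pi.smul_apply, smul_eq_mul]
    congr 1
    exact mulSum_pow_congr _ _ fun b => mulSum_pow_apply _ _ _ _
  rw [hunion, mulSum_union hdisj, (mulSum_commute _ _).add_pow, LinearMap.sum_apply,
    Finset.sum_apply, Finset.sum_range_succ, Finset.sum_congr rfl fun j _ => hterm j, hterm k]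
  have h0 : (mulSum (Finset.Icc 1 ⌊R⌋₊) ^ k)
      (fun b => (mulSum (Finset.Ioc ⌊R⌋₊ N) ^ (k - k)) (fun n => Φ (n * b)) 1) 1 = 0 := by
    have h := abs_mulSum_pow_le (s := Finset.Icc 1 ⌊R⌋₊) (R := R) (K := 0) (fun x hx => by
      rw [Finset.mem_Icc] at hx
      exact ⟨hx.1, (Nat.le_floor_iff hR).1 hx.2⟩) k
      (Φ := fun b => (mulSum (Finset.Ioc ⌊R⌋₊ N) ^ (k - k)) (fun n => Φ (n * b)) 1)
      (fun b _ hbR => by simp [hΦ b hbR])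
    rw [zero_mul] at h
    exact abs_nonpos_iff.1 h
  rw [h0, mul_zero, add_zero]

lemma sum_filter_dvd_sum_piFinset {R : ℝ} (hR : 1 ≤ R) {k n : ℕ} (j : ℕ)
    (f : (Fin (k - 1) → ℕ) → ℝ) :
    ∑ m ∈ (Finset.Icc 1 ⌊R ^ (2 * k - 2)⌋₊).filter (fun m => m ∣ n),
      ∑ ν ∈ (Fintype.piFinset fun _ : Fin (k - 1) => Finset.Icc 1 m).filter
        (fun ν => (∀ i : Fin (k - 1), ((i : ℕ) < j → (ν i : ℝ) ≤ R) ∧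
            (j ≤ (i : ℕ) → R < (ν i : ℝ) ∧ (ν i : ℝ) ≤ R ^ 2)) ∧ ∏ i, ν i = m), f ν =
      ∑ ν ∈ Fintype.piFinset (fun i : Fin (k - 1) =>
        if (i : ℕ) < j then Finset.Icc 1 ⌊R⌋₊ else Finset.Ioc ⌊R⌋₊ ⌊R ^ 2⌋₊),
        if ∏ i, ν i ∣ n then f ν else 0 := by
  have hR0 : 0 ≤ R := by linarith
  set B := Fintype.piFinset (fun i : Fin (k - 1) =>
        if (i : ℕ) < j then Finset.Icc 1 ⌊R⌋₊ else Finset.Ioc ⌊R⌋₊ ⌊R ^ 2⌋₊) with hB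
  have hmem : ∀ ν : Fin (k - 1) → ℕ, ν ∈ B ↔ (∀ i, 1 ≤ ν i) ∧
      ∀ i : Fin (k - 1), ((i : ℕ) < j → (ν i : ℝ) ≤ R) ∧
            (j ≤ (i : ℕ) → R < (ν i : ℝ) ∧ (ν i : ℝ) ≤ R ^ 2) := by
    intro ν
    rw [hB, Fintype.mem_piFinset, ← forall_and]
    refine forall_congr' fun i => ?_
    by_cases h : (i : ℕ) < j
    · simp only [h, if_true, Finset.mem_Icc, Nat.le_floor_iff hR0, not_le.2 h, true_imp_iff,
        false_imp_iff, and_true]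
    · simp only [h, if_false, Finset.mem_Ioc, Nat.le_floor_iff (sq_nonneg R), Nat.floor_lt hR0,
        not_lt.1 h, true_imp_iff, false_imp_iff, true_and]
      refine ⟨fun h1 => ⟨?_, h1⟩, fun h1 => h1.2⟩
      have : (1 : ℝ) ≤ (ν i : ℝ) := hR.trans h1.1.le
      exact_mod_cast this
  have hset : ∀ m ∈ (Finset.Icc 1 ⌊R ^ (2 * k - 2)⌋₊).filter (fun m => m ∣ n),
      (Fintype.piFinset fun _ : Fin (k - 1) => Finset.Icc 1 m).filter
        (fun ν => (∀ i : Fin (k - 1), ((i : ℕ) < j → (ν i : ℝ) ≤ R) ∧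
            (j ≤ (i : ℕ) → R < (ν i : ℝ) ∧ (ν i : ℝ) ≤ R ^ 2)) ∧ ∏ i, ν i = m) =
      B.filter (fun ν => m = ∏ i, ν i) := by
    intro m hm
    rw [Finset.mem_filter, Finset.mem_Icc] at hm
    ext ν
    simp only [Finset.mem_filter, hmem, Fintype.mem_piFinset, Finset.mem_Icc, eq_comm (a := m)]
    constructor
    · rintro ⟨h1, h2, h3⟩
      exact ⟨⟨fun i => (h1 i).1, h2⟩, h3⟩
    · rintro ⟨⟨h1, h2⟩, h3⟩
      refine ⟨fun i => ⟨h1 i, ?_⟩, h2, h3⟩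
      exact Nat.le_of_dvd (by omega) (h3 ▸ Finset.dvd_prod_of_mem ν (Finset.mem_univ i))
  rw [Finset.sum_congr rfl fun m hm => by rw [hset m hm]]
  simp only [Finset.sum_filter (s := B)]
  rw [Finset.sum_comm]
  refine Finset.sum_congr rfl fun ν hν => ?_
  rw [Finset.sum_ite_eq' (Finset.filter _ _)]
  refine if_congr ?_ rfl rfl
  rw [Finset.mem_filter, Finset.mem_Icc]
  refine ⟨fun h => h.2, fun h => ⟨⟨?_, ?_⟩, h⟩⟩
  · exact Finset.prod_pos (f := ν) fun i _ => ((hmem ν).1 hν).1 i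
  · rw [Nat.le_floor_iff (by positivity)]
    push_cast
    calc ∏ i, (ν i : ℝ) ≤ ∏ _i : Fin (k - 1), R ^ 2 := by
          refine Finset.prod_le_prod (fun i _ => by positivity) fun i _ => ?_
          have h1 := ((hmem ν).1 hν).2 i
          rcases lt_or_ge (i : ℕ) j with h2 | h2
          · exact (h1.1 h2).trans (le_self_pow₀ hR (by norm_num))
          · exact (h1.2 h2).2
      _ = R ^ (2 * k - 2) := by
          rw [Finset.prod_const, Finset.card_univ, Fintype.card_fin, ← pow_mul]
          congr 1
          omega

lemma sum_dvd_ite_eq {N m : ℕ} (hm : 0 < m) (g : ℕ → ℝ) (hg : ∀ n, N < n → g n = 0) :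
    ∑ n ∈ Finset.Icc 1 N, (if m ∣ n then g n else 0) = ∑ y ∈ Finset.Icc 1 N, g (m * y) := by
  rw [← Finset.sum_filter, ← Finset.sum_filter_of_ne (p := fun y => m * y ≤ N)
    (s := Finset.Icc 1 N) (f := fun y => g (m * y))
    (fun y _ hy => not_lt.1 fun h => hy (hg _ h))]
  refine Finset.sum_nbij' (fun n => n / m) (fun y => m * y) ?_ ?_ ?_ ?_ ?_
  · intro n hn
    rw [Finset.mem_filter, Finset.mem_Icc] at hn ⊢
    have h1 := Nat.mul_div_cancel' hn.2
    have h2 := Nat.div_le_self n m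
    refine ⟨⟨Nat.div_pos (Nat.le_of_dvd hn.1.1 hn.2) hm, by omega⟩, by omega⟩
  · intro y hy
    rw [Finset.mem_filter, Finset.mem_Icc] at hy ⊢
    exact ⟨⟨Nat.mul_pos hm hy.1.1, hy.2⟩, Nat.dvd_mul_right m y⟩
  · intro n hn
    exact Nat.mul_div_cancel' (Finset.mem_filter.1 hn).2
  · intro y _
    exact Nat.mul_div_cancel_left y hm
  · intro n hn
    rw [Nat.mul_div_cancel' (Finset.mem_filter.1 hn).2]

lemma dkSharp_eq_sum {k : ℕ} {X : ℝ} (hR : 1 ≤ Rk k X) (n : ℕ) :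
    dkSharp k X n = ∑ j ∈ Finset.range k, (k.choose j : ℝ) *
      ∑ ν ∈ Fintype.piFinset (fun i : Fin (k - 1) =>
        if (i : ℕ) < j then Finset.Icc 1 ⌊Rk k X⌋₊ else Finset.Ioc ⌊Rk k X⌋₊ ⌊Rk k X ^ 2⌋₊),
        if ∏ i, ν i ∣ n then
          (Real.log n - Real.log (((∏ i ∈ Finset.univ.filter fun i : Fin (k - 1) => (i : ℕ) < j,
            ν i : ℕ) : ℝ) * Rk k X ^ (k - j))) ^ (k - j - 1) /
          ((Nat.factorial (k - j - 1) : ℝ) * Real.log (Rk k X) ^ (k - j - 1)) else 0 := by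
  simp only [dkSharp, Pm]
  rw [Finset.sum_comm]
  refine Finset.sum_congr rfl fun j _ => ?_
  rw [← Finset.mul_sum, sum_filter_dvd_sum_piFinset hR]
  simp only [Nat.cast_prod]

lemma sum_mul_dkSharp {k : ℕ} {X : ℝ} (hR : 1 ≤ Rk k X) (N : ℕ) (Φ : ℕ → ℝ)
    (hΦ : ∀ n, N < n → Φ n = 0) :
    ∑ n ∈ Finset.Icc 1 N, Φ n * dkSharp k X n = ∑ j ∈ Finset.range k, (k.choose j : ℝ) *
      (mulSum (Finset.Icc 1 ⌊Rk k X⌋₊) ^ j) (fun b =>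
        (mulSum (Finset.Ioc ⌊Rk k X⌋₊ ⌊Rk k X ^ 2⌋₊) ^ (k - 1 - j))
          (fun c => ∑ y ∈ Finset.Icc 1 N, Φ (b * c * y) *
            ((Real.log ((b * c * y : ℕ) : ℝ) - Real.log (b * Rk k X ^ (k - j))) ^ (k - j - 1) /
              ((Nat.factorial (k - j - 1) : ℝ) * Real.log (Rk k X) ^ (k - j - 1)))) 1) 1 := by
  simp only [dkSharp_eq_sum hR, Finset.mul_sum]
  rw [Finset.sum_comm]
  refine Finset.sum_congr rfl fun j hj => ?_
  rw [Finset.mem_range] at hj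
  rw [← sum_piFinset_mixed _ _ (k - 1) j (by omega) (fun b m => ∑ y ∈ Finset.Icc 1 N, Φ (m * y) *
            ((Real.log ((m * y : ℕ) : ℝ) - Real.log (b * Rk k X ^ (k - j))) ^ (k - j - 1) /
              ((Nat.factorial (k - j - 1) : ℝ) * Real.log (Rk k X) ^ (k - j - 1)))),
    Finset.sum_comm, Finset.mul_sum]
  refine Finset.sum_congr rfl fun ν hν => ?_
  have hpos : 0 < ∏ i, ν i := by
    refine Finset.prod_pos (f := ν) fun i _ => ?_
    have h := Fintype.mem_piFinset.1 hν i
    split_ifs at h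
    · exact (Finset.mem_Icc.1 h).1
    · have := (Finset.mem_Ioc.1 h).1
      omega
  rw [← sum_dvd_ite_eq hpos (fun n => Φ n * ((Real.log (n : ℝ) - Real.log
    (((∏ i ∈ Finset.univ.filter fun i : Fin (k - 1) => (i : ℕ) < j, ν i : ℕ) : ℝ) *
      Rk k X ^ (k - j))) ^ (k - j - 1) /
        ((Nat.factorial (k - j - 1) : ℝ) * Real.log (Rk k X) ^ (k - j - 1))))
    (fun n hn => by simp [hΦ n hn]), Finset.mul_sum]
  refine Finset.sum_congr rfl fun n _ => ?_
  split_ifs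
  · ring
  · simp

lemma sum_filter_Ioc_floor_eq (X Z : ℝ) (hX : 0 ≤ X) (hZ : 0 ≤ Z) (a q N : ℕ) (hN : Z ≤ N)
    (f : ℕ → ℝ) :
    ∑ n ∈ (Finset.Ioc ⌊X⌋₊ ⌊Z⌋₊).filter (fun n => n % q = a % q), f n =
      ∑ n ∈ Finset.Icc 1 N, ((if n % q = a % q then 1 else 0) *
        if X < (n : ℝ) ∧ (n : ℝ) ≤ Z then 1 else 0) * f n := by
  have h1 : ∀ n : ℕ, ((if n % q = a % q then 1 else 0) *
        if X < (n : ℝ) ∧ (n : ℝ) ≤ Z then 1 else 0) * f n =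
      if (n % q = a % q ∧ X < (n : ℝ) ∧ (n : ℝ) ≤ Z) then f n else 0 := by
    intro n
    by_cases h2 : n % q = a % q <;> by_cases h3 : X < (n : ℝ) ∧ (n : ℝ) ≤ Z <;> simp [h2, h3]
  simp only [h1]
  rw [← Finset.sum_filter]
  refine Finset.sum_congr ?_ fun _ _ => rfl
  ext n
  simp only [Finset.mem_filter, Finset.mem_Ioc, Finset.mem_Icc, Nat.floor_lt hX,
    Nat.le_floor_iff hZ]
  constructor
  · rintro ⟨⟨h2, h3⟩, h4⟩
    have h5 : (0 : ℝ) < n := by linarith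
    have h6 : (n : ℝ) ≤ N := h3.trans hN
    exact ⟨⟨by exact_mod_cast h5, by exact_mod_cast h6⟩, h4, h2, h3⟩
  · rintro ⟨-, h4, h2, h3⟩
    exact ⟨⟨h2, h3⟩, h4⟩

lemma exists_abs_sum_dk_sub_dkSharp_le_of_small_modulus (k : ℕ) (hk : 2 ≤ k) :
    ∃ C : ℝ, 0 ≤ C ∧ ∀ S X H : ℝ, 1 < S → 2 ≤ X → X = S ^ (100 * k) → Rk k X = S ^ 10 →
      X ≤ H * S ^ 2 → H ≤ X → ∀ a q : ℕ, 0 < q → (q : ℝ) ≤ S ^ 3 →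
        |∑ n ∈ (Finset.Ioc ⌊X⌋₊ ⌊X + H⌋₊).filter (fun n => n % q = a % q),
            ((dk k n : ℝ) - dkSharp k X n)| ≤ C * (H ^ 2 / X) * Real.log X ^ (k - 2) := by
  set M : ℕ → ℝ := fun p => (10 * k * (k + 2)) ^ p with hMdef
  set D : ℕ → ℝ := fun p => 2 * p + (2 * (2 ^ (p + 2) + (p + 1) ^ 2 * M p) + (p + 1) * M p) *
    (100 * k * (k + 2)) with hD
  have hD0 : ∀ p, 0 ≤ D p := fun p => by
    simp only [hD, hMdef]
    positivity
  refine ⟨∑ j ∈ Finset.range k, (k.choose j : ℝ) * (D (k - 1 - j) * (k + 2) ^ (k - 2)), ?_, ?_⟩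
  · refine Finset.sum_nonneg fun j _ => ?_
    have := hD0 (k - 1 - j)
    positivity
  intro S X H hS hX hXS hRS hH hHX a q hq hqS
  have hS0 : 0 < S := by linarith
  have hX0 : 0 < X := by linarith
  have hH0 : 0 ≤ H := by
    have : 0 < H * S ^ 2 := by linarith
    exact (pos_of_mul_pos_left this (by positivity)).le
  obtain ⟨N, hN⟩ := exists_nat_ge (X + H + q)
  have hq0 : (0 : ℝ) ≤ q := Nat.cast_nonneg q
  have hR1 : 1 ≤ S ^ 10 := one_le_pow₀ hS.le
  have hRX : S ^ 10 ≤ X := by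
    rw [hXS]
    exact pow_le_pow_right₀ hS.le (by omega)
  set φ : ℕ → ℝ := fun n => if n % q = a % q then 1 else 0 with hφdef
  have hφ : Function.Periodic φ q := fun n => by simp [hφdef]
  have hφ0 : ∀ n, 0 ≤ φ n := fun n => by simp only [hφdef]; split_ifs <;> norm_num
  have hφ1 : ∀ n, φ n ≤ 1 := fun n => by simp only [hφdef]; split_ifs <;> norm_num
  set Φ : ℕ → ℝ := fun n => φ n * if X < (n : ℝ) ∧ (n : ℝ) ≤ X + H then 1 else 0 with hΦdef
  have hΦN : ∀ n, N < n → Φ n = 0 := by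
    intro n hn
    have h1 : (N : ℝ) < n := by exact_mod_cast hn
    have h2 : ¬ (n : ℝ) ≤ X + H := by linarith
    simp [hΦdef, h2]
  have hΦ0 : ∀ b : ℕ, (b : ℝ) ≤ (S ^ 10) ^ k → Φ b = 0 := by
    intro b hb
    have h2 : ¬ X < (b : ℝ) := by
      rw [not_lt, hXS]
      refine hb.trans ?_
      rw [← pow_mul]
      exact pow_le_pow_right₀ hS.le (by omega)
    simp [hΦdef, h2]
  have hsum : ∑ n ∈ (Finset.Ioc ⌊X⌋₊ ⌊X + H⌋₊).filter (fun n => n % q = a % q),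
            ((dk k n : ℝ) - dkSharp k X n) =
      ∑ n ∈ Finset.Icc 1 N, Φ n * (dk k n : ℝ) - ∑ n ∈ Finset.Icc 1 N, Φ n * dkSharp k X n := by
    rw [sum_filter_Ioc_floor_eq X (X + H) hX0.le (by linarith) a q N (by linarith),
      ← Finset.sum_sub_distrib]
    exact Finset.sum_congr rfl fun n _ => by rw [mul_sub]
  rw [hsum, sum_mul_dk k N Φ hΦN, sum_mul_dkSharp (by rw [hRS]; exact hR1) N Φ hΦN, hRS,
    mulSum_Icc_pow_eq_sum (by linarith) (by linarith : S ^ 10 ≤ N) k hΦ0,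
    ← Finset.sum_sub_distrib]
  have hLS : Real.log X = 10 * k * Real.log (S ^ 10) := by
    rw [hXS, Real.log_pow, Real.log_pow]
    push_cast
    ring
  rw [Finset.sum_mul, Finset.sum_mul]
  refine (Finset.abs_sum_le_sum_abs _ _).trans (Finset.sum_le_sum fun j hj => ?_)
  rw [Finset.mem_range] at hj
  rw [← mul_sub, abs_mul, Nat.abs_cast, mul_assoc, mul_assoc]
  refine mul_le_mul_of_nonneg_left ?_ (Nat.cast_nonneg _)
  have hMp : ((k + 2) * Real.log X) ^ (k - 1 - j) ≤
      M (k - 1 - j) * Real.log (S ^ 10) ^ (k - 1 - j) := by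
    rw [hLS, hMdef, ← mul_pow]
    apply le_of_eq
    ring
  have key := abs_mulSum_mixed_sub_le (show j + (k - 1 - j) + 1 = k by omega) hk hS hX hXS hH hHX
    hq hqS hN hφ hφ0 hφ1 hMp
  rw [show k - j = k - 1 - j + 1 by omega, Nat.add_sub_cancel]
  refine key.trans_eq ?_
  rw [mul_pow]
  ring

lemma exists_succ_pow_le_mul_two_pow (m : ℕ) :
    ∃ B : ℝ, 1 ≤ B ∧ ∀ a : ℕ, ((a : ℝ) + 1) ^ m ≤ B * 2 ^ a := by
  obtain ⟨B, hB⟩ :=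
    (tendsto_pow_const_div_const_pow_of_one_lt m (one_lt_two : (1 : ℝ) < 2)).bddAbove_range
  refine ⟨max 1 (2 * B), le_max_left _ _, fun a => ?_⟩
  have h1 : ((a + 1 : ℕ) : ℝ) ^ m / 2 ^ (a + 1) ≤ B := hB ⟨a + 1, rfl⟩
  rw [div_le_iff₀ (by positivity)] at h1
  push_cast at h1
  calc ((a : ℝ) + 1) ^ m ≤ 2 * B * 2 ^ a := by rw [pow_succ] at h1; linarith
    _ ≤ max 1 (2 * B) * 2 ^ a := by gcongr; exact le_max_right _ _

lemma exists_card_divisors_pow_le (m : ℕ) :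
    ∃ C : ℝ, 1 ≤ C ∧ ∀ n : ℕ, n ≠ 0 → (n.divisors.card : ℝ) ^ m ≤ C * n := by
  obtain ⟨B, hB1, hB⟩ := exists_succ_pow_le_mul_two_pow m
  refine ⟨B ^ 2 ^ m, one_le_pow₀ hB1, fun n hn => ?_⟩
  have hn' : (n : ℝ) = ∏ p ∈ n.primeFactors, (p : ℝ) ^ n.factorization p := by
    conv_lhs => rw [← Nat.prod_factorization_pow_eq_self hn]
    rw [Finsupp.prod, Nat.support_factorization]
    push_cast
    rfl
  have hlocal : ∀ p ∈ n.primeFactors, ((n.factorization p : ℝ) + 1) ^ m ≤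
      (if p < 2 ^ m then B else 1) * (p : ℝ) ^ n.factorization p := by
    intro p hp
    have hp2 : (2 : ℝ) ≤ p := by exact_mod_cast (Nat.prime_of_mem_primeFactors hp).two_le
    split_ifs with h
    · exact (hB _).trans (by gcongr)
    · have h1 : (2 : ℝ) ^ m ≤ p := by exact_mod_cast not_lt.1 h
      have h2 : (n.factorization p : ℝ) + 1 ≤ 2 ^ n.factorization p := by
        exact_mod_cast Nat.lt_two_pow_self
      calc ((n.factorization p : ℝ) + 1) ^ m ≤ (2 ^ n.factorization p) ^ m := by gcongr
        _ = (2 ^ m) ^ n.factorization p := by rw [← pow_mul, ← pow_mul, mul_comm]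
        _ ≤ 1 * (p : ℝ) ^ n.factorization p := by rw [one_mul]; gcongr
  have hcard : ∏ p ∈ n.primeFactors, (if p < 2 ^ m then B else 1) ≤ B ^ 2 ^ m := by
    rw [← Finset.prod_filter, Finset.prod_const]
    refine pow_le_pow_right₀ hB1 ?_
    calc _ ≤ (Finset.range (2 ^ m)).card := Finset.card_le_card fun p hp => by
          simpa using (Finset.mem_filter.1 hp).2
      _ = 2 ^ m := Finset.card_range _
  rw [Nat.card_divisors hn, Nat.cast_prod, ← Finset.prod_pow]
  push_cast
  calc ∏ p ∈ n.primeFactors, ((n.factorization p : ℝ) + 1) ^ m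
      ≤ ∏ p ∈ n.primeFactors, ((if p < 2 ^ m then B else 1) * (p : ℝ) ^ n.factorization p) :=
        Finset.prod_le_prod (fun p _ => by positivity) hlocal
    _ = (∏ p ∈ n.primeFactors, (if p < 2 ^ m then B else 1)) * n := by
        rw [Finset.prod_mul_distrib, ← hn']
    _ ≤ B ^ 2 ^ m * n := by gcongr

lemma dk_le_card_divisors_pow (k : ℕ) {n : ℕ} (hn : n ≠ 0) : dk k n ≤ n.divisors.card ^ k := by
  calc dk k n ≤ (Fintype.piFinset fun _ : Fin k => n.divisors).card := by
        refine Finset.card_le_card fun v hv => ?_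
        rw [Finset.mem_filter] at hv
        rw [Fintype.mem_piFinset]
        exact fun i => Nat.mem_divisors.2
          ⟨hv.2 ▸ Finset.dvd_prod_of_mem v (Finset.mem_univ i), hn⟩
    _ = _ := by simp

lemma abs_dkSharp_le {k : ℕ} {X : ℝ} (hR : 1 < Rk k X)
    (hX : Real.log X = 10 * k * Real.log (Rk k X)) (hX2 : 2 ≤ X) {n : ℕ} (hn : n ≠ 0)
    (hnX : (n : ℝ) ≤ X * X) :
    |dkSharp k X n| ≤ 2 ^ k * (30 * k) ^ k * (n.divisors.card : ℝ) ^ k := by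
  rw [dkSharp_eq_sum hR.le]
  have hlam : 0 < Real.log (Rk k X) := Real.log_pos hR
  have hlogn : Real.log n ≤ 2 * Real.log X := by
    have h1 : (0 : ℝ) < n := by exact_mod_cast Nat.pos_of_ne_zero hn
    have := Real.log_le_log h1 hnX
    rw [Real.log_mul (by linarith) (by linarith)] at this
    linarith
  have hτ : (1 : ℝ) ≤ n.divisors.card := by
    exact_mod_cast Finset.card_pos.2 ⟨1, Nat.one_mem_divisors.2 hn⟩
  have hterm : ∀ j ∈ Finset.range k, |(k.choose j : ℝ) *
      ∑ ν ∈ Fintype.piFinset (fun i : Fin (k - 1) =>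
        if (i : ℕ) < j then Finset.Icc 1 ⌊Rk k X⌋₊ else Finset.Ioc ⌊Rk k X⌋₊ ⌊Rk k X ^ 2⌋₊),
        if ∏ i, ν i ∣ n then
          (Real.log n - Real.log (((∏ i ∈ Finset.univ.filter fun i : Fin (k - 1) => (i : ℕ) < j,
            ν i : ℕ) : ℝ) * Rk k X ^ (k - j))) ^ (k - j - 1) /
          ((Nat.factorial (k - j - 1) : ℝ) * Real.log (Rk k X) ^ (k - j - 1)) else 0| ≤
      (k.choose j : ℝ) * ((30 * k) ^ k * (n.divisors.card : ℝ) ^ k) := by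
    intro j hj
    rw [Finset.mem_range] at hj
    have hk1 : (1 : ℝ) ≤ k := by
      have : 1 ≤ k := by omega
      exact_mod_cast this
    rw [abs_mul, Nat.abs_cast]
    refine mul_le_mul_of_nonneg_left ?_ (Nat.cast_nonneg _)
    rw [← Finset.sum_filter]
    refine (Finset.abs_sum_le_sum_abs _ _).trans ?_
    refine (Finset.sum_le_card_nsmul _ _ ((30 * k : ℝ) ^ k) ?_).trans ?_
    · intro ν hν
      have hνn := (Finset.mem_filter.1 hν).2
      set b := ∏ i ∈ Finset.univ.filter fun i : Fin (k - 1) => (i : ℕ) < j, ν i with hb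
      have hbn : b ∣ n := (Finset.prod_dvd_prod_of_subset _ _ ν (Finset.subset_univ _)).trans hνn
      have hb1 : (1 : ℝ) ≤ b := by exact_mod_cast Nat.pos_of_dvd_of_pos hbn (Nat.pos_of_ne_zero hn)
      have hbn' : (b : ℝ) ≤ n := by exact_mod_cast Nat.le_of_dvd (Nat.pos_of_ne_zero hn) hbn
      have hRp : 0 < Rk k X ^ (k - j) := pow_pos (by linarith) _
      have h1 : Real.log (b * Rk k X ^ (k - j)) =
          Real.log b + ((k - j : ℕ) : ℝ) * Real.log (Rk k X) := by
        rw [Real.log_mul (by linarith) hRp.ne', Real.log_pow]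
      have h2 : ((k - j : ℕ) : ℝ) * Real.log (Rk k X) ≤ k * Real.log (Rk k X) := by
        gcongr
        omega
      have h3 : 0 ≤ ((k - j : ℕ) : ℝ) * Real.log (Rk k X) := by positivity
      have h4 := Real.log_nonneg hb1
      have h5 := Real.log_le_log (by linarith) hbn'
      have h6 : 0 ≤ (k : ℝ) * Real.log (Rk k X) := by positivity
      have h7 : |Real.log n - Real.log (b * Rk k X ^ (k - j))| ≤
          30 * k * Real.log (Rk k X) := by
        rw [h1, abs_le]
        constructor <;> linarith
      have hf : (1 : ℝ) ≤ Nat.factorial (k - j - 1) := by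
        exact_mod_cast Nat.factorial_pos (k - j - 1)
      rw [abs_div, abs_pow, abs_of_pos (show 0 < (Nat.factorial (k - j - 1) : ℝ) *
        Real.log (Rk k X) ^ (k - j - 1) by positivity), div_le_iff₀ (by positivity)]
      calc _ ≤ (30 * k * Real.log (Rk k X)) ^ (k - j - 1) := by gcongr
        _ = (30 * k) ^ (k - j - 1) * (1 * Real.log (Rk k X) ^ (k - j - 1)) := by
          rw [mul_pow, one_mul]
        _ ≤ _ := by
          gcongr
          · linarith
          · omega
    · rw [nsmul_eq_mul, mul_comm]
      gcongr
      have hsub : (Finset.filter (fun ν : Fin (k - 1) → ℕ => ∏ i, ν i ∣ n)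
          (Fintype.piFinset (fun i : Fin (k - 1) =>
            if (i : ℕ) < j then Finset.Icc 1 ⌊Rk k X⌋₊ else
              Finset.Ioc ⌊Rk k X⌋₊ ⌊Rk k X ^ 2⌋₊))).card ≤ n.divisors.card ^ (k - 1) := by
        calc _ ≤ (Fintype.piFinset fun _ : Fin (k - 1) => n.divisors).card := by
              refine Finset.card_le_card fun v hv => ?_
              rw [Finset.mem_filter] at hv
              rw [Fintype.mem_piFinset]
              exact fun i => Nat.mem_divisors.2
                ⟨(Finset.dvd_prod_of_mem v (Finset.mem_univ i)).trans hv.2, hn⟩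
          _ = _ := by simp
      calc _ ≤ (n.divisors.card : ℝ) ^ (k - 1) := by exact_mod_cast hsub
        _ ≤ _ := pow_le_pow_right₀ hτ (by omega)
  refine (Finset.abs_sum_le_sum_abs _ _).trans ((Finset.sum_le_sum hterm).trans ?_)
  rw [← Finset.sum_mul, mul_assoc]
  refine mul_le_mul_of_nonneg_right ?_ (by positivity)
  have h1 := Nat.sum_range_choose k
  have h2 : ∑ j ∈ Finset.range k, k.choose j ≤ 2 ^ k := by
    rw [← h1, Finset.sum_range_succ]
    omega
  exact_mod_cast h2

lemma card_filter_modEq_Ioc_le {X H : ℝ} (hX : 0 ≤ X) (hH : 0 ≤ H) (a : ℕ) {q : ℕ} (hq : 0 < q) :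
    (((Finset.Ioc ⌊X⌋₊ ⌊X + H⌋₊).filter (fun n => n % q = a % q)).card : ℝ) ≤ H / q + 1 := by
  have hq0 : (0 : ℝ) < q := by exact_mod_cast hq
  have h := (abs_mul_sum_Ioc_periodic_sub_le (φ := fun n => if n % q = a % q then 1 else 0)
    (q := q) (fun n => by simp) (fun n => by split_ifs <;> norm_num) hX
    (show X ≤ X + H by linarith)).1
  have h1 : ∑ r ∈ Finset.range q, (if r % q = a % q then (1 : ℝ) else 0) = 1 := by
    rw [Finset.sum_congr rfl (g := fun r => if r = a % q then (1 : ℝ) else 0) fun r hr => by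
      rw [Nat.mod_eq_of_lt (Finset.mem_range.1 hr)], Finset.sum_ite_eq',
      if_pos (Finset.mem_range.2 (Nat.mod_lt _ hq))]
  rw [h1, Finset.sum_boole] at h
  rw [← div_self hq0.ne', ← add_div, le_div_iff₀ hq0]
  linarith

lemma exists_abs_sum_dk_sub_dkSharp_le_of_large_modulus (k : ℕ) (hk : 2 ≤ k) :
    ∃ C : ℝ, 0 ≤ C ∧ ∀ S X H : ℝ, 1 < S → 2 ≤ X → X = S ^ (100 * k) → Rk k X = S ^ 10 →
      X ≤ H * S ^ 2 → H ≤ X → ∀ a q : ℕ, 0 < q → S ^ 3 ≤ (q : ℝ) →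
        |∑ n ∈ (Finset.Ioc ⌊X⌋₊ ⌊X + H⌋₊).filter (fun n => n % q = a % q),
            ((dk k n : ℝ) - dkSharp k X n)| ≤ C * (H ^ 2 / X) * Real.log X ^ (k - 2) := by
  obtain ⟨B, hB1, hB⟩ := exists_card_divisors_pow_le (k * (100 * k))
  refine ⟨2 * ((1 + 2 ^ k * (30 * k) ^ k) * (2 * B)) * 2 ^ (k - 2), by positivity, ?_⟩
  intro S X H hS hX hXS hRS hH hHX a q hq hqS
  have hS0 : 0 < S := by linarith
  have hX0 : 0 < X := by linarith
  have hHS : 0 < H * S ^ 2 := by linarith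
  have hH0 : 0 < H := pos_of_mul_pos_left hHS (by positivity)
  have hL : 1 / 2 ≤ Real.log X := by
    have := Real.log_le_log (by norm_num) hX
    have := Real.log_two_gt_d9
    linarith
  have hLS : Real.log X = 10 * k * Real.log (Rk k X) := by
    rw [hRS, hXS, Real.log_pow, Real.log_pow]
    push_cast
    ring
  have hcount : H / q + 1 ≤ 2 * (H / S ^ 3) := by
    have h1 : H / q ≤ H / S ^ 3 := by gcongr
    have h2 : 1 ≤ H / S ^ 3 := by
      rw [one_le_div (by positivity)]
      have h3 : S ^ 3 * S ^ 2 ≤ H * S ^ 2 := by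
        refine le_trans ?_ hH
        rw [← pow_add, hXS]
        exact pow_le_pow_right₀ hS.le (by omega)
      exact le_of_mul_le_mul_right h3 (by positivity)
    linarith
  have hpt : ∀ n ∈ (Finset.Ioc ⌊X⌋₊ ⌊X + H⌋₊).filter (fun n => n % q = a % q),
      |(dk k n : ℝ) - dkSharp k X n| ≤ (1 + 2 ^ k * (30 * k) ^ k) * (2 * B * S) := by
    intro n hn
    rw [Finset.mem_filter, Finset.mem_Ioc] at hn
    have hn0 : n ≠ 0 := by omega
    have hnX : (n : ℝ) ≤ X + H := (Nat.le_floor_iff (by linarith)).1 hn.1.2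
    have h1 : (dk k n : ℝ) ≤ (n.divisors.card : ℝ) ^ k := by
      exact_mod_cast dk_le_card_divisors_pow k hn0
    have h2 := abs_dkSharp_le (by rw [hRS]; exact one_lt_pow₀ hS (by norm_num)) hLS hX hn0
      (by nlinarith)
    have h3 : (n.divisors.card : ℝ) ^ k ≤ 2 * B * S := by
      refine le_of_pow_le_pow_left₀ (n := 100 * k) (by omega) (by positivity) ?_
      rw [← pow_mul]
      calc (n.divisors.card : ℝ) ^ (k * (100 * k)) ≤ B * n := hB n hn0
        _ ≤ B * (2 * S ^ (100 * k)) := by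
          gcongr
          rw [← hXS]
          linarith
        _ = (2 * B) * S ^ (100 * k) := by ring
        _ ≤ (2 * B) ^ (100 * k) * S ^ (100 * k) := by
          gcongr
          exact le_self_pow₀ (by linarith) (by omega)
        _ = _ := by rw [← mul_pow]
    calc |(dk k n : ℝ) - dkSharp k X n| ≤ |(dk k n : ℝ)| + |dkSharp k X n| := abs_sub _ _
      _ ≤ (n.divisors.card : ℝ) ^ k + 2 ^ k * (30 * k) ^ k * (n.divisors.card : ℝ) ^ k := by
        rw [Nat.abs_cast]
        exact add_le_add h1 h2
      _ = (1 + 2 ^ k * (30 * k) ^ k) * (n.divisors.card : ℝ) ^ k := by ring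
      _ ≤ _ := by gcongr
  have hE : H / S ^ 3 * S ≤ H ^ 2 / X := by
    rw [le_div_iff₀ hX0]
    calc H / S ^ 3 * S * X ≤ H / S ^ 3 * S * (H * S ^ 2) := by gcongr
      _ = H ^ 2 := by field_simp
  have hpow : (1 : ℝ) ≤ 2 ^ (k - 2) * Real.log X ^ (k - 2) := by
    rw [← mul_pow]
    exact one_le_pow₀ (by linarith)
  calc _ ≤ ∑ n ∈ (Finset.Ioc ⌊X⌋₊ ⌊X + H⌋₊).filter (fun n => n % q = a % q),
        |(dk k n : ℝ) - dkSharp k X n| := Finset.abs_sum_le_sum_abs _ _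
    _ ≤ (((Finset.Ioc ⌊X⌋₊ ⌊X + H⌋₊).filter (fun n => n % q = a % q)).card : ℝ) *
        ((1 + 2 ^ k * (30 * k) ^ k) * (2 * B * S)) := by
      rw [← nsmul_eq_mul]
      exact Finset.sum_le_card_nsmul _ _ _ hpt
    _ ≤ 2 * (H / S ^ 3) * ((1 + 2 ^ k * (30 * k) ^ k) * (2 * B * S)) := by
      gcongr
      exact (card_filter_modEq_Ioc_le hX0.le hH0.le a hq).trans hcount
    _ = 2 * ((1 + 2 ^ k * (30 * k) ^ k) * (2 * B)) * (H / S ^ 3 * S) * 1 := by ring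
    _ ≤ 2 * ((1 + 2 ^ k * (30 * k) ^ k) * (2 * B)) * (H ^ 2 / X) *
        (2 ^ (k - 2) * Real.log X ^ (k - 2)) := by gcongr
    _ = _ := by ring

/-- The long-interval estimate (Proposition 3.2(ii)): for `X^{1-1/(50k)} ≤ H₂ ≤ X`, the
sum of `d_k - d_k♯` over `(X, X+H₂]` restricted to any arithmetic progression
`a (mod q)` is at most `C (H₂²/X) (log X)^{k-2}`. -/
theorem divisor_long_interval_approx (k : ℕ) (hk : 2 ≤ k) :
    ∃ C : ℝ, 0 < C ∧ ∀ X H₂ : ℝ, 2 ≤ X →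
      X ^ ((1 : ℝ) - 1 / (50 * k)) ≤ H₂ → H₂ ≤ X →
      ∀ a q : ℕ, 0 < a → 0 < q →
        |∑ n ∈ (Finset.Ioc ⌊X⌋₊ ⌊X + H₂⌋₊).filter (fun n => n % q = a % q),
            ((dk k n : ℝ) - dkSharp k X n)|
          ≤ C * (H₂ ^ 2 / X) * Real.log X ^ (k - 2) := by
  obtain ⟨C₁, hC₁, h₁⟩ := exists_abs_sum_dk_sub_dkSharp_le_of_small_modulus k hk
  obtain ⟨C₂, hC₂, h₂⟩ := exists_abs_sum_dk_sub_dkSharp_le_of_large_modulus k hk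
  refine ⟨C₁ + C₂ + 1, by positivity, fun X H hX hH hHX a q _ hq => ?_⟩
  have hX0 : 0 < X := by linarith
  have hk0 : (0 : ℝ) < k := by exact_mod_cast (by omega : 0 < k)
  set S : ℝ := X ^ ((1 : ℝ) / (100 * k)) with hS
  have hS1 : 1 < S := Real.one_lt_rpow (by linarith) (by positivity)
  have hSpow : ∀ m : ℕ, S ^ m = X ^ ((1 : ℝ) / (100 * k) * m) := fun m => by
    rw [hS, ← Real.rpow_natCast, ← Real.rpow_mul hX0.le]
  have hXS : X = S ^ (100 * k) := by
    rw [hSpow, Nat.cast_mul, Nat.cast_ofNat, one_div, inv_mul_cancel₀ (by positivity),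
      Real.rpow_one]
  have hRS : Rk k X = S ^ 10 := by
    rw [hSpow, Rk]
    congr 1
    field_simp
    norm_num
  have hHS : X ≤ H * S ^ 2 := by
    calc X = X ^ ((1 : ℝ) - 1 / (50 * k)) * S ^ 2 := by
          rw [hSpow, ← Real.rpow_add hX0]
          conv_lhs => rw [← Real.rpow_one X]
          congr 1
          push_cast
          field_simp
          ring
      _ ≤ H * S ^ 2 := by gcongr
  have hE : 0 ≤ H ^ 2 / X := by positivity
  have hL : 0 ≤ Real.log X ^ (k - 2) := pow_nonneg (Real.log_nonneg (by linarith)) _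
  rcases le_total (q : ℝ) (S ^ 3) with hqS | hqS
  · refine (h₁ S X H hS1 hX hXS hRS hHS hHX a q hq hqS).trans ?_
    gcongr
    linarith
  · refine (h₂ S X H hS1 hX hXS hRS hHS hHX a q hq hqS).trans ?_
    gcongr
    linarith
end

section
/- Let α₁, …, α_k be nonnegative reals with ∑_{i=1}^k α_i = 1, and let 1/3 ≤ θ ≤ 1. For I ⊆ {1, …, k} write α_I := ∑_{i ∈ I} α_i. Consider the statements: (I) α_i ≥ 1 − θ for some i; (I₂^maj) α_{{i,j}} ≥ 1 − θ for some i < j; (I₂) α_{{i,j}} ≥ (3/2)(1 − θ) for some i < j; (II^maj) there is a partition {1, …, k} = I ⊎ J ⊎ J′ with 2θ − 1 ≤ α_I ≤ 4θ − 2 and |α_J − α_{J′}| ≤ 2θ − 1; (II^min) there is a partition {1, …, k} = J ⊎ J′ with |α_J − α_{J′}| ≤ 2θ − 1. Then: (i) if θ = 5/8 then (I) or (II^maj) holds; (ii) if θ ≥ 3/5 then (I), (I₂), or (II^min) holds; (iii) if θ = 7/12 then (I), (I₂^maj), or (II^maj) holds; (iv) if k = 5 and θ = 11/20 then (I₂^maj)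 or (II^maj) holds; (v) if k ∈ {3,4} and θ ≥ 1/2 then (I₂^maj) holds; (vi) if k = 3 and θ ≥ 5/9, or k = 2 and θ ≥ 1/3, then (I₂) holds. -/
open Finset

/-- Statement (I): some `α_i ≥ 1 - θ`. -/
def StI {k : ℕ} (α : Fin k → ℝ) (θ : ℝ) : Prop := ∃ i, 1 - θ ≤ α i

/-- Statement (I₂^maj): some `α_i + α_j ≥ 1 - θ` with `i ≠ j`. -/
def StI2maj {k : ℕ} (α : Fin k → ℝ) (θ : ℝ) : Prop :=
  ∃ i j, i ≠ j ∧ 1 - θ ≤ α i + α j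

/-- Statement (I₂): some `α_i + α_j ≥ (3/2)(1 - θ)` with `i ≠ j`. -/
def StI2 {k : ℕ} (α : Fin k → ℝ) (θ : ℝ) : Prop :=
  ∃ i j, i ≠ j ∧ 3 / 2 * (1 - θ) ≤ α i + α j

/-- Statement (II^maj): there is a partition `{1,…,k} = I ⊎ J ⊎ J'` with
`2θ-1 ≤ α_I ≤ 4θ-2` and `|α_J - α_{J'}| ≤ 2θ-1`. -/
def StIImaj {k : ℕ} (α : Fin k → ℝ) (θ : ℝ) : Prop :=
  ∃ I J J' : Finset (Fin k),
    Disjoint I J ∧ Disjoint I J' ∧ Disjoint J J' ∧ I ∪ J ∪ J' = Finset.univ ∧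
    2 * θ - 1 ≤ ∑ i ∈ I, α i ∧ (∑ i ∈ I, α i) ≤ 4 * θ - 2 ∧
    |(∑ i ∈ J, α i) - ∑ i ∈ J', α i| ≤ 2 * θ - 1

/-- Statement (II^min): there is a partition `{1,…,k} = J ⊎ J'` with
`|α_J - α_{J'}| ≤ 2θ-1`. -/
def StIImin {k : ℕ} (α : Fin k → ℝ) (θ : ℝ) : Prop :=
  ∃ J : Finset (Fin k), |(∑ i ∈ J, α i) - ∑ i ∈ Jᶜ, α i| ≤ 2 * θ - 1

/-- Greedy signing: with steps bounded by `c`, a starting value `d` can be brought into `[-c, c]`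
as soon as the total step length suffices. -/
theorem exists_subset_abs_add_sub_le {ι : Type*} [DecidableEq ι] (α : ι → ℝ) (c : ℝ)
    (S : Finset ι) (hα : ∀ i ∈ S, 0 ≤ α i) (hc : ∀ i ∈ S, α i ≤ c) (d : ℝ)
    (hd : |d| ≤ c + ∑ i ∈ S, α i) :
    ∃ T ⊆ S, |d + ∑ i ∈ T, α i - ∑ i ∈ S \ T, α i| ≤ c := by
  induction S using Finset.induction_on generalizing d with
  | empty => exact ⟨∅, subset_rfl, by simpa using hd⟩
  | insert a S ha ih =>
    have hα' : ∀ i ∈ S, 0 ≤ α i := fun i hi => hα i (mem_insert_of_mem hi)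
    have hc' : ∀ i ∈ S, α i ≤ c := fun i hi => hc i (mem_insert_of_mem hi)
    have ha0 := hα a (mem_insert_self a S)
    have hac := hc a (mem_insert_self a S)
    have hS : 0 ≤ ∑ i ∈ S, α i := sum_nonneg hα'
    rw [sum_insert ha, abs_le] at hd
    rcases le_total 0 d with h | h
    · obtain ⟨T, hT, hb⟩ := ih hα' hc' (d - α a) (abs_le.2 ⟨by linarith, by linarith⟩)
      have haT : a ∉ T := fun h => ha (hT h)
      refine ⟨T, hT.trans (subset_insert a S), ?_⟩
      rw [insert_sdiff_of_notMem _ haT, sum_insert (by simp [ha])]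
      convert hb using 2
      ring
    · obtain ⟨T, hT, hb⟩ := ih hα' hc' (d + α a) (abs_le.2 ⟨by linarith, by linarith⟩)
      have haT : a ∉ T := fun h => ha (hT h)
      refine ⟨insert a T, insert_subset_insert a hT, ?_⟩
      rw [insert_sdiff_insert, sdiff_insert_of_notMem ha, sum_insert haT]
      convert hb using 2
      ring

/-- A subset sum first reaching `c` with steps bounded by `c` lies in `[c, 2c]`. -/
theorem exists_subset_sum_mem_Icc {ι : Type*} [DecidableEq ι] (α : ι → ℝ) (c : ℝ)
    (S : Finset ι) (hc : ∀ i ∈ S, α i ≤ c) (h0 : 0 ≤ c) (hS : c ≤ ∑ i ∈ S, α i) :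
    ∃ T ⊆ S, c ≤ ∑ i ∈ T, α i ∧ ∑ i ∈ T, α i ≤ 2 * c := by
  induction S using Finset.induction_on with
  | empty => exact ⟨∅, subset_rfl, hS, by simpa using h0⟩
  | insert a S ha ih =>
    by_cases h : c ≤ ∑ i ∈ S, α i
    · obtain ⟨T, hT, hb⟩ := ih (fun i hi => hc i (mem_insert_of_mem hi)) h
      exact ⟨T, hT.trans (subset_insert a S), hb⟩
    · refine ⟨insert a S, subset_rfl, hS, ?_⟩
      rw [sum_insert ha]
      linarith [hc a (mem_insert_self a S)]

/-- Disjoint sets `P`, `N` outside `I` extend to a balanced partition of the complement of `I`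
when the remaining elements are small but their total is large enough. -/
theorem exists_balanced_partition {ι : Type*} [Fintype ι] [DecidableEq ι] (α : ι → ℝ) (c : ℝ)
    (hα : ∀ i, 0 ≤ α i) (hsum : ∑ i, α i = 1) (I P N : Finset ι) (hIP : Disjoint I P)
    (hIN : Disjoint I N) (hPN : Disjoint P N) (hc : ∀ i, c < α i → i ∈ I ∪ P ∪ N)
    (h₁ : 2 * ∑ i ∈ P, α i ≤ c + 1 - ∑ i ∈ I, α i)
    (h₂ : 2 * ∑ i ∈ N, α i ≤ c + 1 - ∑ i ∈ I, α i) :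
    ∃ J J' : Finset ι, Disjoint I J ∧ Disjoint I J' ∧ Disjoint J J' ∧ I ∪ J ∪ J' = univ ∧
      |∑ i ∈ J, α i - ∑ i ∈ J', α i| ≤ c := by
  have hR : ∑ i ∈ (I ∪ P ∪ N)ᶜ, α i
      = 1 - ∑ i ∈ I, α i - ∑ i ∈ P, α i - ∑ i ∈ N, α i := by
    have h := sum_add_sum_compl (I ∪ P ∪ N) α
    rw [sum_union (disjoint_union_left.2 ⟨hIN, hPN⟩), sum_union hIP, hsum] at h
    linarith
  obtain ⟨T, hT, hb⟩ := exists_subset_abs_add_sub_le α c (I ∪ P ∪ N)ᶜ (fun i _ => hα i)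
    (fun i hi => not_lt.1 fun h => mem_compl.1 hi (hc i h)) (∑ i ∈ P, α i - ∑ i ∈ N, α i)
    (abs_le.2 ⟨by linarith, by linarith⟩)
  have hT' : Disjoint (I ∪ P ∪ N) T := disjoint_compl_right.mono_right hT
  have hU : Disjoint (I ∪ P ∪ N) ((I ∪ P ∪ N)ᶜ \ T) :=
    disjoint_compl_right.mono_right sdiff_subset
  simp only [disjoint_union_left] at hT' hU
  refine ⟨P ∪ T, N ∪ ((I ∪ P ∪ N)ᶜ \ T), ?_, ?_, ?_, ?_, ?_⟩
  · exact disjoint_union_right.2 ⟨hIP, hT'.1.1⟩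
  · exact disjoint_union_right.2 ⟨hIN, hU.1.1⟩
  · simp only [disjoint_union_left, disjoint_union_right]
    exact ⟨⟨hPN, hT'.2.symm⟩, hU.1.2, disjoint_sdiff⟩
  · ext i
    simp only [mem_union, mem_sdiff, mem_compl, mem_univ, iff_true]
    tauto
  · rw [sum_union hT'.1.2, sum_union hU.2]
    convert hb using 2
    ring

/-- A finset can be enumerated so that `α` is non-increasing. -/
theorem exists_antitone_enumeration {ι : Type*} (α : ι → ℝ) (L : Finset ι) {m : ℕ}
    (hm : L.card = m) :
    ∃ f : Fin m → ι, Function.Injective f ∧ (∀ i, i ∈ L ↔ ∃ j, f j = i) ∧ Antitone (α ∘ f) := by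
  let e := (L.equivFinOfCardEq hm).symm
  let g : Fin m → ℝ := fun j => - α (e j)
  refine ⟨fun j => e (Tuple.sort g j), ?_, fun i => ⟨fun hi => ?_, ?_⟩, fun a b hab => ?_⟩
  · exact Subtype.val_injective.comp (e.injective.comp (Tuple.sort g).injective)
  · exact ⟨(Tuple.sort g).symm (e.symm ⟨i, hi⟩), by simp⟩
  · rintro ⟨j, rfl⟩
    exact (e _).2
  · simpa [g] using Tuple.monotone_sort g hab

/-- The elements exceeding `c`, of which there are fewer than `m` when `m * c ≥ 1`, enumerated in
non-increasing order. -/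
theorem exists_enumeration_large {ι : Type*} [Fintype ι] (α : ι → ℝ) (hα : ∀ i, 0 ≤ α i)
    (hsum : ∑ i, α i = 1) (c : ℝ) (n : ℕ) (hn : 0 < n) (hc : 1 ≤ n * c) :
    ∃ m < n, ∃ f : Fin m → ι, Function.Injective f ∧ (∀ i, c < α i ↔ ∃ j, f j = i) ∧
      Antitone (α ∘ f) ∧ ∑ j, α (f j) ≤ 1 := by
  classical
  set L : Finset ι := univ.filter (fun i => c < α i) with hL
  obtain ⟨f, hf, hfL, hanti⟩ := exists_antitone_enumeration α L rfl
  have hle : ∑ j, α (f j) ≤ 1 := by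
    rw [← hsum, ← sum_image (f := α) (s := univ) (g := f) hf.injOn]
    exact sum_le_sum_of_subset_of_nonneg (subset_univ _) fun i _ _ => hα i
  have hmem : ∀ i, c < α i ↔ ∃ j, f j = i := fun i => by rw [← hfL, hL]; simp
  refine ⟨L.card, ?_, f, hf, hmem, hanti, hle⟩
  by_contra! h
  have hne : (univ : Finset (Fin L.card)).Nonempty := ⟨⟨0, by omega⟩, mem_univ _⟩
  have hlt : ∑ _j : Fin L.card, c < ∑ j, α (f j) :=
    sum_lt_sum_of_nonempty hne fun j _ => (hmem _).2 ⟨j, rfl⟩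
  have hc0 : 0 ≤ c := by
    by_contra! hneg
    nlinarith [(Nat.cast_pos (α := ℝ)).2 hn]
  have : (n : ℝ) * c ≤ L.card * c := mul_le_mul_of_nonneg_right (by exact_mod_cast h) hc0
  simp only [sum_const, card_univ, Fintype.card_fin, nsmul_eq_mul] at hlt
  linarith

theorem StIImaj.of_balanced {k : ℕ} {α : Fin k → ℝ} (hα : ∀ i, 0 ≤ α i) (hsum : ∑ i, α i = 1)
    {θ c : ℝ} (hθ : c = 2 * θ - 1) (I P N : Finset (Fin k)) (hI₁ : c ≤ ∑ i ∈ I, α i)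
    (hI₂ : ∑ i ∈ I, α i ≤ 2 * c) (hIP : Disjoint I P) (hIN : Disjoint I N) (hPN : Disjoint P N)
    (hc : ∀ i, c < α i → i ∈ I ∪ P ∪ N)
    (h₁ : 2 * ∑ i ∈ P, α i ≤ c + 1 - ∑ i ∈ I, α i)
    (h₂ : 2 * ∑ i ∈ N, α i ≤ c + 1 - ∑ i ∈ I, α i) : StIImaj α θ := by
  obtain ⟨J, J', h⟩ := exists_balanced_partition α c hα hsum I P N hIP hIN hPN hc h₁ h₂
  subst hθ
  exact ⟨I, J, J', h.1, h.2.1, h.2.2.1, h.2.2.2.1, hI₁, by linarith, h.2.2.2.2⟩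

theorem StIImin.of_balanced {k : ℕ} {α : Fin k → ℝ} (hα : ∀ i, 0 ≤ α i) (hsum : ∑ i, α i = 1)
    {θ : ℝ} (P N : Finset (Fin k)) (hPN : Disjoint P N)
    (hc : ∀ i, 2 * θ - 1 < α i → i ∈ P ∪ N) (h₁ : ∑ i ∈ P, α i ≤ θ)
    (h₂ : ∑ i ∈ N, α i ≤ θ) : StIImin α θ := by
  obtain ⟨J, J', h⟩ := exists_balanced_partition α (2 * θ - 1) hα hsum ∅ P N (by simp) (by simp)
    hPN (by simpa using hc) (by simp; linarith) (by simp; linarith)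
  have hJ : Jᶜ = J' := by
    rw [compl_eq_iff_isCompl]
    exact ⟨h.2.2.1, codisjoint_iff.2 (by simpa using h.2.2.2.1)⟩
  exact ⟨J, hJ ▸ h.2.2.2.2⟩

theorem stI_or_stIImaj {k : ℕ} {α : Fin k → ℝ} (hα : ∀ i, 0 ≤ α i) (hsum : ∑ i, α i = 1) :
    StI α (5 / 8) ∨ StIImaj α (5 / 8) := by
  rw [or_iff_not_imp_left]
  intro hI
  simp only [StI, not_exists, not_le] at hI
  obtain ⟨m, hm, f, hf, hlarge, hanti, hle⟩ :=
    exists_enumeration_large α hα hsum (1 / 4) 4 (by norm_num) (by norm_num)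
  have hθ : (1 / 4 : ℝ) = 2 * (5 / 8) - 1 := by norm_num
  have hgt : ∀ j, 1 / 4 < α (f j) := fun j => (hlarge _).2 ⟨j, rfl⟩
  have hlt : ∀ j, α (f j) < 1 - 5 / 8 := fun j => hI (f j)
  interval_cases m
  · have hsmall : ∀ i, α i ≤ 1 / 4 := fun i => not_lt.1 fun h => by simpa using (hlarge i).1 h
    obtain ⟨I, -, h₁, h₂⟩ := exists_subset_sum_mem_Icc α (1 / 4) univ (fun i _ => hsmall i)
      (by norm_num) (by rw [hsum]; norm_num)
    refine .of_balanced hα hsum hθ I ∅ ∅ h₁ h₂ (by simp) (by simp) (by simp)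
      (fun i hi => absurd hi (hsmall i).not_gt) ?_ ?_ <;> rw [sum_empty] <;> linarith
  · refine .of_balanced hα hsum hθ {f 0} ∅ ∅ ?_ ?_ ?_ ?_ ?_
      (fun i hi => by obtain ⟨j, rfl⟩ := (hlarge i).1 hi; fin_cases j; simp)
      ?_ ?_ <;>
      simp <;> linarith [hgt 0, hlt 0]
  · refine .of_balanced hα hsum hθ {f 1} {f 0} ∅ ?_ ?_ ?_ ?_ ?_
      (fun i hi => by obtain ⟨j, rfl⟩ := (hlarge i).1 hi; fin_cases j <;> simp)
      ?_ ?_ <;>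
      simp [hf.eq_iff] <;> linarith [hgt 0, hlt 0, hgt 1, hlt 1]
  · refine .of_balanced hα hsum hθ {f 2} {f 0} {f 1} ?_ ?_ ?_ ?_ ?_
      (fun i hi => by obtain ⟨j, rfl⟩ := (hlarge i).1 hi; fin_cases j <;> simp)
      ?_ ?_ <;>
      simp [hf.eq_iff] <;> linarith [hgt 0, hlt 0, hgt 1, hlt 1, hgt 2, hlt 2]

theorem stI_or_stI2_or_stIImin {k : ℕ} {α : Fin k → ℝ} (hα : ∀ i, 0 ≤ α i)
    (hsum : ∑ i, α i = 1) {θ : ℝ} (hθ : 3 / 5 ≤ θ) : StI α θ ∨ StI2 α θ ∨ StIImin α θ := by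
  rw [or_iff_not_imp_left, or_iff_not_imp_left]
  intro hI hI2
  simp only [StI, StI2, not_exists, not_and, not_le] at hI hI2
  obtain ⟨m, hm, f, hf, hlarge, hanti, hle⟩ :=
    exists_enumeration_large α hα hsum (2 * θ - 1) 5 (by norm_num) (by norm_num; linarith)
  have hgt : ∀ j, 2 * θ - 1 < α (f j) := fun j => (hlarge _).2 ⟨j, rfl⟩
  have hlt : ∀ j, α (f j) < 1 - θ := fun j => hI (f j)
  have hpair : ∀ i j, i ≠ j → α (f i) + α (f j) < 3 / 2 * (1 - θ) :=
    fun i j hij => hI2 _ _ (hf.ne hij)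
  interval_cases m
  · refine .of_balanced hα hsum ∅ ∅ ?_
      (fun i hi => by obtain ⟨j, rfl⟩ := (hlarge i).1 hi; exact j.elim0)
      ?_ ?_ <;>
      simp <;> linarith
  · refine .of_balanced hα hsum {f 0} ∅ ?_
      (fun i hi => by obtain ⟨j, rfl⟩ := (hlarge i).1 hi; fin_cases j; simp)
      ?_ ?_ <;>
      simp <;> linarith [hlt 0]
  · refine .of_balanced hα hsum {f 0} {f 1} ?_
      (fun i hi => by obtain ⟨j, rfl⟩ := (hlarge i).1 hi; fin_cases j <;> simp)
      ?_ ?_ <;>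
      simp [hf.eq_iff] <;> linarith [hlt 0, hlt 1]
  · have h12 := hpair 1 2 (by decide)
    refine .of_balanced hα hsum {f 0} {f 1, f 2} ?_
      (fun i hi => by obtain ⟨j, rfl⟩ := (hlarge i).1 hi; fin_cases j <;> simp)
      ?_ ?_ <;>
      simp [hf.eq_iff] <;> linarith [hlt 0]
  · have h01 : α (f 1) ≤ α (f 0) := hanti (by decide)
    have h23 : α (f 3) ≤ α (f 2) := hanti (by decide)
    simp only [Fin.sum_univ_four] at hle
    refine .of_balanced hα hsum {f 0, f 3} {f 1, f 2} ?_
      (fun i hi => by obtain ⟨j, rfl⟩ := (hlarge i).1 hi; fin_cases j <;> simp)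
      ?_ ?_ <;>
      simp [hf.eq_iff] <;>
      linarith [hgt 0, hlt 0, hgt 1, hlt 1, hgt 2, hlt 2, hgt 3, hlt 3]

theorem stI_or_stI2maj_or_stIImaj {k : ℕ} {α : Fin k → ℝ} (hα : ∀ i, 0 ≤ α i)
    (hsum : ∑ i, α i = 1) : StI α (7 / 12) ∨ StI2maj α (7 / 12) ∨ StIImaj α (7 / 12) := by
  rw [or_iff_not_imp_left, or_iff_not_imp_left]
  intro hI hI2
  simp only [StI, StI2maj, not_exists, not_and, not_le] at hI hI2
  obtain ⟨m, hm, f, hf, hlarge, hanti, hle⟩ :=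
    exists_enumeration_large α hα hsum (1 / 6) 6 (by norm_num) (by norm_num)
  have hθ : (1 / 6 : ℝ) = 2 * (7 / 12) - 1 := by norm_num
  have hgt : ∀ j, 1 / 6 < α (f j) := fun j => (hlarge _).2 ⟨j, rfl⟩
  have hlt : ∀ j, α (f j) < 1 - 7 / 12 := fun j => hI (f j)
  have hpair : ∀ i j, i ≠ j → α (f i) + α (f j) < 1 - 7 / 12 :=
    fun i j hij => hI2 _ _ (hf.ne hij)
  interval_cases m
  · have hsmall : ∀ i, α i ≤ 1 / 6 := fun i => not_lt.1 fun h => by simpa using (hlarge i).1 h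
    obtain ⟨I, -, h₁, h₂⟩ := exists_subset_sum_mem_Icc α (1 / 6) univ (fun i _ => hsmall i)
      (by norm_num) (by rw [hsum]; norm_num)
    refine .of_balanced hα hsum hθ I ∅ ∅ h₁ h₂ (by simp) (by simp) (by simp)
      (fun i hi => absurd hi (hsmall i).not_gt) ?_ ?_ <;> rw [sum_empty] <;> linarith
  · have hrest : α (f 0) + ∑ i ∈ univ.erase (f 0), α i = 1 := by
      rw [add_sum_erase _ _ (mem_univ _), hsum]
    obtain ⟨I, hI, h₁, h₂⟩ := exists_subset_sum_mem_Icc α (1 / 6) (univ.erase (f 0))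
      (fun i hi => not_lt.1 fun h => (mem_erase.1 hi).1 <| by
        obtain ⟨j, rfl⟩ := (hlarge i).1 h
        rw [Subsingleton.elim j 0])
      (by norm_num) (by linarith [hlt 0])
    have h0 : f 0 ∉ I := fun h => by simpa using hI h
    refine .of_balanced hα hsum hθ I {f 0} ∅ h₁ h₂ (by simpa using h0) (by simp) (by simp)
      (fun i hi => by obtain ⟨j, rfl⟩ := (hlarge i).1 hi; fin_cases j; simp)
      ?_ ?_ <;>
      simp <;> linarith [hlt 0]
  · have h01 : α (f 1) ≤ α (f 0) := hanti (by decide)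
    have p01 := hpair 0 1 (by decide)
    refine .of_balanced hα hsum hθ {f 1} {f 0} ∅ ?_ ?_ ?_ ?_ ?_
      (fun i hi => by obtain ⟨j, rfl⟩ := (hlarge i).1 hi; fin_cases j <;> simp)
      ?_ ?_ <;>
      simp [hf.eq_iff] <;> linarith [hgt 0, hlt 0, hgt 1, hlt 1]
  · have h01 : α (f 1) ≤ α (f 0) := hanti (by decide)
    have h12 : α (f 2) ≤ α (f 1) := hanti (by decide)
    have p01 := hpair 0 1 (by decide)
    have p02 := hpair 0 2 (by decide)
    refine .of_balanced hα hsum hθ {f 2} {f 0} {f 1} ?_ ?_ ?_ ?_ ?_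
      (fun i hi => by obtain ⟨j, rfl⟩ := (hlarge i).1 hi; fin_cases j <;> simp)
      ?_ ?_ <;>
      simp [hf.eq_iff] <;> linarith [hlt 0, hgt 2]
  · have h01 : α (f 1) ≤ α (f 0) := hanti (by decide)
    have h12 : α (f 2) ≤ α (f 1) := hanti (by decide)
    have h23 : α (f 3) ≤ α (f 2) := hanti (by decide)
    have p01 := hpair 0 1 (by decide)
    refine .of_balanced hα hsum hθ {f 3} {f 0} {f 1, f 2} ?_ ?_ ?_ ?_ ?_
      (fun i hi => by obtain ⟨j, rfl⟩ := (hlarge i).1 hi; fin_cases j <;> simp)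
      ?_ ?_ <;>
      simp [hf.eq_iff] <;> linarith [hlt 0, hgt 3]
  · have h01 : α (f 1) ≤ α (f 0) := hanti (by decide)
    have h12 : α (f 2) ≤ α (f 1) := hanti (by decide)
    have h23 : α (f 3) ≤ α (f 2) := hanti (by decide)
    have h34 : α (f 4) ≤ α (f 3) := hanti (by decide)
    simp only [Fin.sum_univ_five] at hle
    refine .of_balanced hα hsum hθ {f 4} {f 0, f 3} {f 1, f 2} ?_ ?_ ?_ ?_ ?_
      (fun i hi => by obtain ⟨j, rfl⟩ := (hlarge i).1 hi; fin_cases j <;> simp)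
      ?_ ?_ <;>
      simp [hf.eq_iff] <;> linarith [hgt 3, hgt 4, hpair 0 1 (by decide), hgt 2]

theorem stI2maj_or_stIImaj_five {α : Fin 5 → ℝ} (hα : ∀ i, 0 ≤ α i) (hsum : ∑ i, α i = 1) :
    StI2maj α (11 / 20) ∨ StIImaj α (11 / 20) := by
  rw [or_iff_not_imp_left]
  intro hI2
  simp only [StI2maj, not_exists, not_and, not_le] at hI2
  have hθ : (1 / 10 : ℝ) = 2 * (11 / 20) - 1 := by norm_num
  obtain ⟨f, hf, hmem, hanti⟩ := exists_antitone_enumeration α univ (card_fin 5)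
  have htotal : ∑ j, α (f j) = 1 := by
    rw [← hsum]
    exact (Finite.injective_iff_bijective.1 hf).sum_comp α
  simp only [Fin.sum_univ_five] at htotal
  have h01 : α (f 1) ≤ α (f 0) := hanti (by decide)
  have h12 : α (f 2) ≤ α (f 1) := hanti (by decide)
  have h23 : α (f 3) ≤ α (f 2) := hanti (by decide)
  have h34 : α (f 4) ≤ α (f 3) := hanti (by decide)
  have p01 := hI2 _ _ (hf.ne (show (0 : Fin 5) ≠ 1 by decide))
  refine .of_balanced hα hsum hθ {f 4} {f 0, f 3} {f 1, f 2} ?_ ?_ ?_ ?_ ?_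
    (fun i _ => by obtain ⟨j, rfl⟩ := (hmem i).1 (mem_univ i); fin_cases j <;> simp)
    ?_ ?_ <;>
    simp [hf.eq_iff] <;> linarith

/-- Lemma 2.13 (combinatorial lemma): for nonnegative `α₁, …, α_k` summing to `1` and
`1/3 ≤ θ ≤ 1`, the six claims (i)–(vi). -/
theorem combinatorial_lemma (k : ℕ) (α : Fin k → ℝ) (hα : ∀ i, 0 ≤ α i)
    (hsum : ∑ i, α i = 1) (θ : ℝ) (hθ₁ : 1 / 3 ≤ θ) (hθ₂ : θ ≤ 1) :
    (θ = 5 / 8 → StI α θ ∨ StIImaj α θ) ∧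
    (3 / 5 ≤ θ → StI α θ ∨ StI2 α θ ∨ StIImin α θ) ∧
    (θ = 7 / 12 → StI α θ ∨ StI2maj α θ ∨ StIImaj α θ) ∧
    (k = 5 ∧ θ = 11 / 20 → StI2maj α θ ∨ StIImaj α θ) ∧
    ((k = 3 ∨ k = 4) ∧ 1 / 2 ≤ θ → StI2maj α θ) ∧
    ((k = 3 ∧ 5 / 9 ≤ θ) ∨ (k = 2 ∧ 1 / 3 ≤ θ) → StI2 α θ) := by
  refine ⟨?_, stI_or_stI2_or_stIImin hα hsum, ?_, ?_, ?_, ?_⟩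
  · rintro rfl
    exact stI_or_stIImaj hα hsum
  · rintro rfl
    exact stI_or_stI2maj_or_stIImaj hα hsum
  · rintro ⟨rfl, rfl⟩
    exact stI2maj_or_stIImaj_five hα hsum
  · rintro ⟨rfl | rfl, hθ⟩ <;> by_contra h <;>
      simp only [StI2maj, not_exists, not_and, not_le] at h
    · rw [Fin.sum_univ_three] at hsum
      linarith [h 0 1 (by decide), hα 2, h 0 2 (by decide), h 1 2 (by decide)]
    · rw [Fin.sum_univ_four] at hsum
      linarith [h 0 1 (by decide), h 2 3 (by decide)]
  · rintro (⟨rfl, hθ⟩ | ⟨rfl, hθ⟩) <;> by_contra h <;>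
      simp only [StI2, not_exists, not_and, not_le] at h
    · rw [Fin.sum_univ_three] at hsum
      linarith [h 0 1 (by decide), h 0 2 (by decide), h 1 2 (by decide)]
    · rw [Fin.sum_univ_two] at hsum
      linarith [h 0 1 (by decide)]
end
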